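/- Let k be an algebraically closed field and let A be a finite-dimensional unital associative k-algebra such that J(A)² = 0 and there is a k-algebra isomorphism A/J(A) ≅ M_{r_1}(k) × M_{r_2}(k) × ⋯ × M_{r_K}(k) with r_i ≥ 6 for every i = 1, …, K. Then A has finitely many conjugacy classes of left ideals if and only if A is of finite representation type. -/

import Mathlib

/-- Two left ideals `L, L'` of a ring `A` are conjugate if `L' = u L u⁻¹` for a unit `u`. -/
def ConjLeftIdeal (A : Type) [Ring A] (L L' : Submodule A A) : Prop :=
  ∃ u : Aˣ, (L' : Set A) = (fun x => (u : A) * x * ((u⁻¹ : Aˣ) : A)) '' (L : Set A)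

/-- `A` has finitely many conjugacy classes of left ideals. -/
def HasFinitelyManyConjClassesOfLeftIdeals (A : Type) [Ring A] : Prop :=
  Finite (Quot (ConjLeftIdeal A))

/-- An `A`-module is indecomposable if it is nonzero and admits no pair of nonzero
complementary submodules. -/
def IsIndecomposableModule (A : Type) [Ring A] (N : Type) [AddCommGroup N] [Module A N] : Prop :=
  (∃ v : N, v ≠ 0) ∧
    ∀ N₁ N₂ : Submodule A N, IsCompl N₁ N₂ → N₁ = ⊥ ∨ N₂ = ⊥

/-- `A` is of finite representation type: there are only finitely many isomorphism classes of
finite(-dimensional) indecomposable left `A`-modules. -/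
def FiniteRepresentationType (A : Type) [Ring A] : Prop :=
  ∃ (ι : Type) (_ : Finite ι) (M : ι → ModuleCat.{0} A),
    ∀ (N : ModuleCat.{0} A), Module.Finite A N → IsIndecomposableModule A N →
      ∃ i, Nonempty (N ≃ₗ[A] M i)

/-- Twice the Tits form of a (multi)graph with adjacency matrix `B`. -/
def titsForm {V : Type*} [Fintype V] (B : V → V → ℤ) (z : V → ℤ) : ℤ :=
  ∑ i, z i * (2 * z i - ∑ j, B i j * z j)

namespace titsForm

variable {V : Type*} [Fintype V] {B : V → V → ℤ}

theorem eq_sub (z : V → ℤ) :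
    titsForm B z = 2 * ∑ i, z i ^ 2 - ∑ i, ∑ j, B i j * (z i * z j) := by
  simp only [titsForm, Finset.mul_sum, mul_sub, Finset.sum_sub_distrib]
  congr 1
  · exact Finset.sum_congr rfl fun i _ => by ring
  · exact Finset.sum_congr rfl fun i _ => Finset.sum_congr rfl fun j _ => by ring

theorem sub_single [DecidableEq V] (hs : ∀ i j, B i j = B j i) (hd : ∀ i, B i i = 0)
    (z : V → ℤ) (i : V) :
    titsForm B (z - Pi.single i 1) =
      titsForm B z - 2 * (2 * z i - ∑ j, B i j * z j) + 2 := by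
  have h1 : ∀ k, ∑ j, B k j *
      (z j - (Pi.single i (1 : ℤ) : V → ℤ) j) = ∑ j, B k j * z j - B k i := by
    intro k
    simp [mul_sub, Finset.sum_sub_distrib, Pi.single_apply]
  have h2 : ∑ k, z k * B k i = ∑ j, B i j * z j :=
    Finset.sum_congr rfl fun k _ => by rw [hs k i]; ring
  have h3 : ∑ k, (Pi.single i (1 : ℤ) : V → ℤ) k *
      (2 * z k - 2 * (Pi.single i (1 : ℤ) : V → ℤ) k - ∑ j, B k j * z j + B k i) =
      2 * z i - 2 - ∑ j, B i j * z j := by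
    simp [Pi.single_apply, hd]
  have h4 : ∑ k, z k * (Pi.single i (1 : ℤ) : V → ℤ) k = z i := by simp [Pi.single_apply]
  simp only [titsForm, Pi.sub_apply, h1]
  calc _ = ∑ k, (z k * (2 * z k - ∑ j, B k j * z j) - 2 * (z k * (Pi.single i (1 : ℤ) : V → ℤ) k)
        + z k * B k i - (Pi.single i (1 : ℤ) : V → ℤ) k *
      (2 * z k - 2 * (Pi.single i (1 : ℤ) : V → ℤ) k - ∑ j, B k j * z j + B k i)) := by
        refine Finset.sum_congr rfl fun k _ => ?_
        ring
    _ = _ := by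
        rw [Finset.sum_sub_distrib, Finset.sum_add_distrib, Finset.sum_sub_distrib,
          ← Finset.mul_sum, h2, h3, h4]
        ring

/-- A vector equal to `2` on `P` and to `1` on the vertices adjacent to `P` violates positivity
when the degrees on `P` are too large. -/
theorem sum_card_lt [DecidableEq V] (hs : ∀ i j, B i j = B j i) (h0 : ∀ i j, 0 ≤ B i j)
    (H : ∀ w : V → ℤ, 0 ≤ w → (∀ i, w i ≤ 6) → w ≠ 0 → 0 < titsForm B w)
    (N : V → Finset V) (hN : ∀ i, ∀ j ∈ N i, 1 ≤ B i j) (P : Finset V) (hP : P.Nonempty) :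
    ∑ i ∈ P, ((N i ∩ P).card + (N i).card) < 4 * P.card := by
  set T := P.biUnion N \ P with hT
  set f : V → ℤ := fun i => if i ∈ P then 1 else 0 with hf
  set g : V → ℤ := fun i => if i ∈ T then 1 else 0 with hg
  have hf0 : ∀ i, 0 ≤ f i := fun i => by simp only [hf]; split_ifs <;> norm_num
  have hg0 : ∀ i, 0 ≤ g i := fun i => by simp only [hg]; split_ifs <;> norm_num
  have hw := H (fun i => 2 * f i + g i)
    (fun i => by have := hf0 i; have := hg0 i; simp only [Pi.zero_apply]; linarith)
    (fun i => by simp only [hf, hg]; split_ifs <;> norm_num)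
    (by
      obtain ⟨i, hi⟩ := hP
      intro h
      have h1 := congrFun h i
      have h2 : f i = 1 := by simp [hf, hi]
      have := hg0 i
      simp only [Pi.zero_apply, h2] at h1
      linarith)
  rw [eq_sub] at hw
  have hsq : ∑ i, (2 * f i + g i) ^ 2 = 4 * (P.card : ℤ) + T.card := by
    have : ∀ i, (2 * f i + g i) ^ 2 = 4 * f i + g i := by
      intro i
      by_cases h : i ∈ P
      · have : i ∉ T := by simp [hT, h]
        simp [hf, hg, h, this]
      · by_cases h' : i ∈ T <;> simp [hf, hg, h, h']
    simp only [this, Finset.sum_add_distrib, ← Finset.mul_sum]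
    simp [hf, hg]
  have hTc : (T.card : ℤ) ≤ ∑ i ∈ P, ((N i \ P).card : ℤ) := by
    have : T = P.biUnion fun i => N i \ P := by
      ext x; simp only [hT, Finset.mem_sdiff, Finset.mem_biUnion]; tauto
    rw [this]
    exact_mod_cast Finset.card_biUnion_le
  have hff : 4 * ∑ i ∈ P, ((N i ∩ P).card : ℤ) ≤ ∑ i, ∑ j, B i j * (4 * (f i * f j)) := by
    have : ∀ i ∈ P, ((N i ∩ P).card : ℤ) ≤ ∑ j, B i j * f j := by
      intro i hi
      calc ((N i ∩ P).card : ℤ) = ∑ j ∈ N i ∩ P, 1 := by simp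
        _ ≤ ∑ j ∈ N i ∩ P, B i j * f j := by
          refine Finset.sum_le_sum fun j hj => ?_
          rw [Finset.mem_inter] at hj
          simpa [hf, hj.2] using hN i j hj.1
        _ ≤ _ := Finset.sum_le_univ_sum_of_nonneg fun j => mul_nonneg (h0 _ _) (hf0 _)
    calc 4 * ∑ i ∈ P, ((N i ∩ P).card : ℤ) ≤ 4 * ∑ i ∈ P, ∑ j, B i j * f j := by
          gcongr with i hi; exact this i hi
      _ = 4 * ∑ i, f i * ∑ j, B i j * f j := by simp [hf, Finset.sum_ite_mem]
      _ = _ := by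
          simp only [Finset.mul_sum]
          exact Finset.sum_congr rfl fun i _ => Finset.sum_congr rfl fun j _ => by ring
  have hfg : 2 * ∑ i ∈ P, ((N i \ P).card : ℤ) ≤ ∑ i, ∑ j, B i j * (2 * (f i * g j)) := by
    have : ∀ i ∈ P, ((N i \ P).card : ℤ) ≤ ∑ j, B i j * g j := by
      intro i hi
      calc ((N i \ P).card : ℤ) = ∑ j ∈ N i \ P, 1 := by simp
        _ ≤ ∑ j ∈ N i \ P, B i j * g j := by
          refine Finset.sum_le_sum fun j hj => ?_
          rw [Finset.mem_sdiff] at hj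
          have : j ∈ T := by
            rw [hT, Finset.mem_sdiff, Finset.mem_biUnion]; exact ⟨⟨i, hi, hj.1⟩, hj.2⟩
          simpa [hg, this] using hN i j hj.1
        _ ≤ _ := Finset.sum_le_univ_sum_of_nonneg fun j => mul_nonneg (h0 _ _) (hg0 _)
    calc 2 * ∑ i ∈ P, ((N i \ P).card : ℤ) ≤ 2 * ∑ i ∈ P, ∑ j, B i j * g j := by
          gcongr with i hi; exact this i hi
      _ = 2 * ∑ i, f i * ∑ j, B i j * g j := by simp [hf, Finset.sum_ite_mem]
      _ = _ := by
          simp only [Finset.mul_sum]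
          exact Finset.sum_congr rfl fun i _ => Finset.sum_congr rfl fun j _ => by ring
  have hgf : ∑ i, ∑ j, B i j * (2 * (g i * f j)) = ∑ i, ∑ j, B i j * (2 * (f i * g j)) := by
    rw [Finset.sum_comm]
    exact Finset.sum_congr rfl fun i _ => Finset.sum_congr rfl fun j _ => by rw [hs]; ring
  have hgg : 0 ≤ ∑ i, ∑ j, B i j * (g i * g j) :=
    Finset.sum_nonneg fun i _ => Finset.sum_nonneg fun j _ =>
      mul_nonneg (h0 _ _) (mul_nonneg (hg0 _) (hg0 _))
  have hexp : ∑ i, ∑ j, B i j * ((2 * f i + g i) * (2 * f j + g j)) =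
      ∑ i, ∑ j, B i j * (4 * (f i * f j)) + ∑ i, ∑ j, B i j * (2 * (f i * g j)) +
      ∑ i, ∑ j, B i j * (2 * (g i * f j)) + ∑ i, ∑ j, B i j * (g i * g j) := by
    simp only [← Finset.sum_add_distrib]
    exact Finset.sum_congr rfl fun i _ => Finset.sum_congr rfl fun j _ => by ring
  have hcard : ∑ i ∈ P, ((N i).card : ℤ) =
      ∑ i ∈ P, ((N i ∩ P).card : ℤ) + ∑ i ∈ P, ((N i \ P).card : ℤ) := by
    rw [← Finset.sum_add_distrib]
    refine Finset.sum_congr rfl fun i _ => ?_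
    exact_mod_cast (Finset.card_inter_add_card_sdiff (N i) P).symm
  zify
  rw [Finset.sum_add_distrib, hcard]
  linarith

/-- A tree embedded in the graph, given by its parent function, on which some bounded vector
has nonpositive form. -/
theorem tree_form_pos (hs : ∀ i j, B i j = B j i) (h0 : ∀ i j, 0 ≤ B i j)
    (H : ∀ w : V → ℤ, 0 ≤ w → (∀ i, w i ≤ 6) → w ≠ 0 → 0 < titsForm B w)
    {n : ℕ} (f : Fin (n + 1) → V) (hf : Function.Injective f) (par : Fin (n + 1) → Fin (n + 1))
    (hpar : ∀ s, s ≠ 0 → 1 ≤ B (f s) (f (par s)))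
    (c : Fin (n + 1) → ℤ) (hc : ∀ s, 0 < c s) (hc6 : ∀ s, c s ≤ 6)
    (hlt : ∀ s, s ≠ 0 → par s < s) :
    0 < ∑ s, c s ^ 2 - ∑ s, if s = 0 then 0 else c s * c (par s) := by
  classical
  set w : V → ℤ := fun v => ∑ s, if f s = v then c s else 0 with hw
  have hwf : ∀ s, w (f s) = c s := by
    intro s
    simp [hw, hf.eq_iff]
  have hwz : ∀ v, v ∉ Set.range f → w v = 0 := by
    intro v hv
    refine Finset.sum_eq_zero fun s _ => if_neg fun h => hv ⟨s, h⟩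
  have hwB : ∀ v, 0 ≤ w v ∧ w v ≤ 6 := by
    intro v
    by_cases hv : v ∈ Set.range f
    · obtain ⟨s, rfl⟩ := hv
      rw [hwf]; exact ⟨(hc s).le, hc6 s⟩
    · rw [hwz v hv]; norm_num
  have hsum : ∀ F : V → ℤ, (∀ v, v ∉ Set.range f → F v = 0) → ∑ v, F v = ∑ s, F (f s) := by
    intro F hF
    rw [← Finset.sum_image (f := F) (s := Finset.univ) (g := f) (fun a _ b _ h => hf h)]
    symm
    refine Finset.sum_subset (Finset.subset_univ _) fun v _ hv => hF v ?_
    simpa using hv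
  have h := H w (fun v => (hwB v).1) (fun v => (hwB v).2) (fun h => by
    have h1 := congrFun h (f 0)
    rw [hwf] at h1
    exact (hc 0).ne' h1)
  rw [eq_sub, hsum (fun v => w v ^ 2) (fun v hv => by simp [hwz v hv]),
    hsum (fun v => ∑ j, B v j * (w v * w j)) (fun v hv => by simp [hwz v hv])] at h
  simp only [hwf] at h
  have h2 : ∀ s, ∑ j, B (f s) j * (c s * w j) = ∑ t, B (f s) (f t) * (c s * c t) := by
    intro s
    rw [hsum (fun j => B (f s) j * (c s * w j)) (fun v hv => by simp [hwz v hv])]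
    simp [hwf]
  simp only [h2] at h
  have hE : ∀ s t : Fin (n + 1), ((if s ≠ 0 ∧ t = par s then c s * c t else 0) +
      (if t ≠ 0 ∧ s = par t then c t * c s else 0) : ℤ) ≤ B (f s) (f t) * (c s * c t) := by
    intro s t
    have hp : 0 < c s * c t := mul_pos (hc s) (hc t)
    by_cases h1 : s ≠ 0 ∧ t = par s
    · have h3 : ¬ (t ≠ 0 ∧ s = par t) := by
        rintro ⟨ht, hst⟩
        have a1 := hlt s h1.1
        have a2 := hlt t ht
        rw [← h1.2] at a1
        rw [← hst] at a2
        exact lt_asymm a1 a2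
      rw [if_pos h1, if_neg h3]
      have := hpar s h1.1
      rw [← h1.2] at this
      nlinarith
    · rw [if_neg h1]
      by_cases h3 : t ≠ 0 ∧ s = par t
      · rw [if_pos h3]
        have := hpar t h3.1
        rw [← h3.2, hs] at this
        nlinarith
      · rw [if_neg h3]
        have := mul_nonneg (h0 (f s) (f t)) hp.le
        linarith
  have hE2 := Finset.sum_le_sum fun s (_ : s ∈ Finset.univ) =>
    Finset.sum_le_sum fun t (_ : t ∈ Finset.univ) => hE s t
  simp only [Finset.sum_add_distrib] at hE2
  rw [Finset.sum_comm (f := fun s t => if t ≠ 0 ∧ s = par t then c t * c s else 0)] at hE2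
  have h5 : ∀ s, ∑ t, (if s ≠ 0 ∧ t = par s then c s * c t else 0) =
      if s = 0 then 0 else c s * c (par s) := by
    intro s
    by_cases hs0 : s = 0 <;> simp [hs0]
  simp only [h5] at hE2
  linarith

theorem exists_harmonic [DecidableEq V] (hs : ∀ i j, B i j = B j i) (hd : ∀ i, B i i = 0)
    (hev : ∀ z, Even (titsForm B z))
    (H : ∀ w : V → ℤ, 0 ≤ w → (∀ i, w i ≤ 6) → w ≠ 0 → 0 < titsForm B w)
    (hbad : ∃ z : V → ℤ, 0 ≤ z ∧ z ≠ 0 ∧ titsForm B z ≤ 0) :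
    ∃ z : V → ℤ, 0 ≤ z ∧ z ≠ 0 ∧ ∀ i, 0 < z i → ∑ j, B i j * z j = 2 * z i := by
  obtain ⟨n, ⟨z, ⟨hz0, hzne, hzQ⟩, hn⟩, hmin⟩ := WellFounded.has_min (r := (· < ·)) wellFounded_lt
    {n : ℕ | ∃ z : V → ℤ, (0 ≤ z ∧ z ≠ 0 ∧ titsForm B z ≤ 0) ∧ ∑ i, z i = n} (by
      obtain ⟨z, hz⟩ := hbad
      exact
          ⟨(∑ i, z i).toNat, z, hz,
              (Int.toNat_of_nonneg (Finset.sum_nonneg fun i _ => hz.1 i)).symm⟩)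
  refine ⟨z, hz0, hzne, ?_⟩
  have hle : ∀ i, z i ≤ ∑ j, z j := fun i =>
    Finset.single_le_sum (fun j _ => hz0 j) (Finset.mem_univ i)
  have hstep : ∀ i, 0 < z i → 2 * (2 * z i - ∑ j, B i j * z j) ≤ titsForm B z := by
    intro i hi
    have hQ := sub_single hs hd z i
    have hz' : 0 ≤ z - Pi.single i 1 := by
      intro k
      have := hz0 k
      by_cases hk : k = i
      · subst hk; simp; linarith
      · simpa [hk] using this
    have hpos : 0 < titsForm B (z - Pi.single i 1) := by
      by_cases h0 : z - Pi.single i 1 = 0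
      · exfalso
        refine absurd (H z hz0 (fun k => ?_) hzne) (not_lt.2 hzQ)
        rw [sub_eq_zero.1 h0, Pi.single_apply]
        split_ifs <;> norm_num
      · by_contra hneg
        refine hmin (n - 1) ⟨_, ⟨hz', h0, not_lt.1 hneg⟩, ?_⟩ ?_
        · simp only [Pi.sub_apply, Finset.sum_sub_distrib, hn]
          have := hle i
          simp
          omega
        · have := hle i
          show n - 1 < n
          omega
    have := (hev (z - Pi.single i 1)).two_dvd
    omega
  have hsum : ∑ i, z i * (2 * (2 * z i - ∑ j, B i j * z j)) = 2 * titsForm B z := by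
    rw [titsForm, Finset.mul_sum]
    exact Finset.sum_congr rfl fun i _ => by ring
  have hpt : ∀ i, z i * (2 * (2 * z i - ∑ j, B i j * z j)) ≤ z i * titsForm B z := by
    intro i
    rcases (hz0 i).eq_or_lt with h | h
    · simp only [Pi.zero_apply] at h; simp [← h]
    · exact mul_le_mul_of_nonneg_left (hstep i h) h.le
  have hQ0 : titsForm B z = 0 := by
    by_contra hne
    have hneg : titsForm B z < 0 := lt_of_le_of_ne hzQ hne
    have h1 := Finset.sum_le_sum fun i (_ : i ∈ Finset.univ) => hpt i
    rw [hsum, ← Finset.sum_mul] at h1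
    have h2 : ∑ i, z i ≤ 2 := by nlinarith
    exact absurd (H z hz0 (fun i => by have := hle i; linarith) hzne) (not_lt.2 hzQ)
  intro i hi
  have h1 : ∀ i ∈ Finset.univ, z i * (2 * (2 * z i - ∑ j, B i j * z j)) = 0 := by
    have hnp : ∀ i ∈ Finset.univ, z i * (2 * (2 * z i - ∑ j, B i j * z j)) ≤ 0 := by
      intro i _
      have := hpt i
      rwa [hQ0, mul_zero] at this
    rw [hQ0, mul_zero] at hsum
    exact (Finset.sum_eq_zero_iff_of_nonpos hnp).1 hsum
  rcases mul_eq_zero.1 (h1 i (Finset.mem_univ i)) with h | h <;> linarith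

theorem adj_le_one [DecidableEq V] (hs : ∀ i j, B i j = B j i) (hd : ∀ i, B i i = 0)
    (H : ∀ w : V → ℤ, 0 ≤ w → (∀ i, w i ≤ 6) → w ≠ 0 → 0 < titsForm B w) (i j : V) :
    B i j ≤ 1 := by
  by_cases hij : i = j
  · rw [hij, hd]; norm_num
  have h1 : titsForm B (Pi.single j 1) = 2 := by
    have := sub_single hs hd (Pi.single j 1) j
    simp [Pi.single_apply, hd] at this
    simp [titsForm] at this ⊢
    linarith
  have h2 := sub_single hs hd (Pi.single j 1 + Pi.single i 1) i
  rw [add_sub_cancel_right, h1] at h2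
  simp [Pi.single_apply, hd, mul_add, Finset.sum_add_distrib, hij] at h2
  have h3 := H (Pi.single j 1 + Pi.single i 1)
    (fun k => by simp [Pi.single_apply]; split_ifs <;> norm_num)
    (fun k => by simp [Pi.single_apply]; split_ifs <;> norm_num)
    (fun h => by have := congrFun h i; simp [hij] at this)
  linarith

/-- A function on the vertices of a finite tree that embeds injectively because every vertex has at
most one neighbour that is larger with respect to a height function `z`. -/
theorem tree_injective {V : Type*} {n : ℕ} {N : V → Finset V} {z : V → ℤ}
    (huniq : ∀ i, ∀ j ∈ N i, ∀ k ∈ N i, z i < z j → z i < z k → j = k)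
    (f : Fin (n + 1) → V) (par : Fin (n + 1) → Fin (n + 1)) (hlt : ∀ s, s ≠ 0 → par s < s)
    (hmax : ∀ i, z i ≤ z (f 0))
    (hN : ∀ s, s ≠ 0 → f (par s) ∈ N (f s)) (hz : ∀ s, s ≠ 0 → z (f s) < z (f (par s)))
    (hsib : ∀ s t, s ≠ 0 → t ≠ 0 → par s = par t → f s = f t → s = t) :
    Function.Injective f := by
  suffices ∀ m : ℕ, ∀ s : Fin (n + 1), s.val = m → ∀ t, f s = f t → s = t from fun s =>
    this _ _ rfl
  intro m
  induction m using Nat.strong_induction_on with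
  | _ m ih =>
    intro s hsm t h
    by_cases hs0 : s = 0
    · subst hs0
      by_contra ht
      have h1 := hz t (Ne.symm ht)
      rw [← h] at h1
      exact absurd (hmax (f (par t))) (not_le.2 h1)
    by_cases ht0 : t = 0
    · subst ht0
      have h1 := hz s hs0
      rw [h] at h1
      exact absurd (hmax (f (par s))) (not_le.2 h1)
    have h1 : f (par s) = f (par t) := by
      refine huniq (f s) _ (hN s hs0) _ (by rw [h]; exact hN t ht0) (hz s hs0) ?_
      rw [h]; exact hz t ht0
    have h2 := ih (par s).val (by rw [← hsm]; exact hlt s hs0) (par s) rfl (par t) h1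
    exact hsib s t hs0 ht0 h2 h

/-- A positive harmonic function on a graph, with neighbourhoods `N`, such that the vectors with
coefficients at most `6` have positive Tits form. -/
structure IsBadHarmonic (B : V → V → ℤ) (z : V → ℤ) (N : V → Finset V) : Prop where
  symm : ∀ i j, B i j = B j i
  nonneg : ∀ i j, 0 ≤ B i j
  form_pos : ∀ w : V → ℤ, 0 ≤ w → (∀ i, w i ≤ 6) → w ≠ 0 → 0 < titsForm B w
  adj : ∀ i, ∀ j ∈ N i, 1 ≤ B i j
  mem_symm : ∀ i j, 0 < z i → j ∈ N i → i ∈ N j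
  pos : ∀ i, ∀ j ∈ N i, 0 < z j
  sum_eq : ∀ i, 0 < z i → ∑ j ∈ N i, z j = 2 * z i

namespace IsBadHarmonic

variable {z : V → ℤ} {N : V → Finset V}

theorem larger_unique [DecidableEq V] (h : IsBadHarmonic B z N) (i : V) (j : V) (hj : j ∈ N i)
    (k : V) (hk : k ∈ N i) (hzj : z i < z j)
    (hzk : z i < z k) (hi : 0 < z i) : j = k := by
  by_contra hjk
  have h1 : ∑ l ∈ ({j, k} : Finset V), z l ≤ ∑ l ∈ N i, z l :=
    Finset.sum_le_sum_of_subset_of_nonneg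
      (by intro x hx; simp only [Finset.mem_insert, Finset.mem_singleton] at hx
          rcases hx with rfl | rfl <;> assumption)
      (fun l hl _ => (h.pos i l hl).le)
  rw [Finset.sum_pair hjk, h.sum_eq i hi] at h1
  linarith

theorem exists_mem [DecidableEq V] (h : IsBadHarmonic B z N) (P : Finset V) (hP : P.Nonempty) :
    ∃ i ∈ P, (N i ∩ P).card + (N i).card < 4 := by
  by_contra! hc
  have h1 := sum_card_lt h.symm h.nonneg h.form_pos N h.adj P hP
  have h2 := Finset.sum_le_sum hc
  simp only [Finset.sum_const, smul_eq_mul] at h2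
  omega

theorem card_le_three [DecidableEq V] (h : IsBadHarmonic B z N) (i : V) : (N i).card ≤ 3 := by
  obtain ⟨j, hj, hlt⟩ := h.exists_mem {i} (Finset.singleton_nonempty i)
  rw [Finset.mem_singleton] at hj
  subst hj
  omega

theorem eq_of_card_le_two (h : IsBadHarmonic B z N) {i : V} {m : ℤ} (hi : 0 < z i) (him : z i = m)
    (hm : ∀ j, z j ≤ m)
    (hc : (N i).card ≤ 2) : (N i).card = 2 ∧ ∀ j ∈ N i, z j = m := by
  have hs := h.sum_eq i hi
  have hle : ∑ j ∈ N i, z j ≤ ((N i).card : ℤ) * m := by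
    have := Finset.sum_le_card_nsmul (N i) z m fun j _ => hm j
    simpa using this
  have h2 : (N i).card = 2 := by
    by_contra hne
    have h3 : ((N i).card : ℤ) ≤ 1 := by exact_mod_cast (by omega : (N i).card ≤ 1)
    nlinarith
  refine ⟨h2, fun j hj => ?_⟩
  have h3 : ∑ j ∈ N i, (m - z j) = 0 := by
    rw [Finset.sum_sub_distrib, hs]; simp [h2]; linarith
  have := (Finset.sum_eq_zero_iff_of_nonneg fun j _ => sub_nonneg.2 (hm j)).1 h3 j hj
  linarith

theorem lt_of_mem_of_max [DecidableEq V] (h : IsBadHarmonic B z N) {m : ℤ} (hm0 : 0 < m)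
    (hm : ∀ j, z j ≤ m) {i j : V} (hi : z i = m)
    (hj : j ∈ N i) : z j < m := by
  by_contra hcon
  have hjm : z j = m := le_antisymm (hm j) (not_lt.1 hcon)
  set P := Finset.univ.filter fun i => z i = m ∧ ∃ j ∈ N i, z j = m with hP
  obtain ⟨v, hv, hlt⟩ := h.exists_mem P
    ⟨i, Finset.mem_filter.2 ⟨Finset.mem_univ _, hi, j, hj, hjm⟩⟩
  simp only [hP, Finset.mem_filter, Finset.mem_univ, true_and] at hv
  obtain ⟨hvm, k, hk, hkm⟩ := hv
  have hv0 : 0 < z v := hvm ▸ hm0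
  have hmem : ∀ k ∈ N v, z k = m → k ∈ N v ∩ P := by
    intro k hk hkm
    simp only [hP, Finset.mem_inter, Finset.mem_filter, Finset.mem_univ, true_and]
    exact ⟨hk, hkm, v, h.mem_symm v k hv0 hk, hvm⟩
  have hpos : 0 < (N v ∩ P).card := Finset.card_pos.2 ⟨k, hmem k hk hkm⟩
  by_cases hc : (N v).card ≤ 2
  · obtain ⟨h2, hall⟩ := h.eq_of_card_le_two hv0 hvm hm hc
    have : N v ∩ P = N v := Finset.inter_eq_left.2 fun k hk =>
      (Finset.mem_inter.1 (hmem k hk (hall k hk))).2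
    rw [this] at hlt
    omega
  · omega

theorem card_eq_three [DecidableEq V] (h : IsBadHarmonic B z N) {m : ℤ} (hm0 : 0 < m)
    (hm : ∀ j, z j ≤ m) {i : V} (hi : z i = m) :
    (N i).card = 3 := by
  refine le_antisymm (h.card_le_three i) ?_
  by_contra hc
  obtain ⟨h2, hall⟩ := h.eq_of_card_le_two (hi ▸ hm0) hi hm (by omega)
  obtain ⟨j, hj⟩ := Finset.card_pos.1 (by omega : 0 < (N i).card)
  exact (h.lt_of_mem_of_max hm0 hm hi hj).ne (hall j hj)

/-- From a maximal vertex the harmonic function decreases linearly along an arm. -/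
theorem exists_arm [DecidableEq V] (h : IsBadHarmonic B z N) {m : ℤ} (hm0 : 0 < m)
    (hm : ∀ j, z j ≤ m) {a v : V} (ha : z a = m)
    (hv : v ∈ N a) {d : ℤ} (hd : z v = m - d) (l : ℕ) (hl : (l + 1 : ℤ) * d < m) :
    ∃ p : ℕ → V, p 0 = a ∧ p 1 = v ∧ (∀ t ≤ l + 1, z (p t) = m - t * d) ∧
      ∀ t < l + 1, p t ∈ N (p (t + 1)) := by
  have hd0 : 0 < d := by
    have := h.lt_of_mem_of_max hm0 hm ha hv
    linarith
  induction l with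
  | zero =>
    refine ⟨fun t => if t = 0 then a else v, rfl, rfl, fun t ht => ?_, fun t ht => ?_⟩
    · interval_cases t <;> simp [ha, hd]
    · interval_cases t
      simpa using h.mem_symm a v (ha ▸ hm0) hv
  | succ l ih =>
    push_cast at hl
    obtain ⟨p, hp0, hp1, hpz, hpN⟩ := ih (by nlinarith)
    have hpos : ∀ t ≤ l + 1, 0 < z (p t) := by
      intro t ht
      rw [hpz t ht]
      have : (t : ℤ) ≤ l + 1 := by exact_mod_cast ht
      nlinarith
    have hpN' : ∀ t < l + 1, p (t + 1) ∈ N (p t) := fun t ht =>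
      h.mem_symm _ _ (hpos _ (by omega)) (hpN t ht)
    have hpne : ∀ s ≤ l + 1, ∀ t ≤ l + 1, s ≠ t → p s ≠ p t := by
      intro s hs t ht hst heq
      have h1 := hpz s hs
      rw [heq, hpz t ht] at h1
      have h2 : (t : ℤ) * d = s * d := by linarith
      exact hst (by exact_mod_cast (mul_right_cancel₀ hd0.ne' h2).symm)
    have hcard : (N (p (l + 1))).card ≤ 2 := by
      by_contra hc
      obtain ⟨i, hi, hlt⟩ := h.exists_mem ((Finset.range (l + 2)).image p)
          ⟨p 0, by simp; exact ⟨0, by omega, rfl⟩⟩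
      obtain ⟨t, ht, rfl⟩ := Finset.mem_image.1 hi
      rw [Finset.mem_range] at ht
      have hmemP : ∀ s ≤ l + 1, p s ∈ (Finset.range (l + 2)).image p := fun s hs =>
        Finset.mem_image_of_mem p (Finset.mem_range.2 (by omega))
      rcases Nat.eq_zero_or_pos t with rfl | ht0
      · have h1 : 0 < (N (p 0) ∩ (Finset.range (l + 2)).image p).card :=
          Finset.card_pos.2 ⟨p 1, Finset.mem_inter.2 ⟨hpN' 0 (by omega), hmemP 1 (by omega)⟩⟩
        have h2 := h.card_eq_three hm0 hm (hp0.symm ▸ ha : z (p 0) = m)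
        omega
      obtain ⟨t, rfl⟩ : ∃ s, t = s + 1 := ⟨t - 1, by omega⟩
      have hpm : p t ∈ N (p (t + 1)) ∩ (Finset.range (l + 2)).image p :=
        Finset.mem_inter.2 ⟨hpN t (by omega), hmemP t (by omega)⟩
      by_cases htl : t = l
      · subst htl
        have h1 := Finset.card_pos.2 ⟨_, hpm⟩
        omega
      · have hpm2 : p (t + 2) ∈ N (p (t + 1)) ∩ (Finset.range (l + 2)).image p :=
          Finset.mem_inter.2 ⟨hpN' (t + 1) (by omega), hmemP (t + 2) (by omega)⟩
        have h1 : 1 < (N (p (t + 1)) ∩ (Finset.range (l + 2)).image p).card :=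
          Finset.one_lt_card.2 ⟨_, hpm, _, hpm2, hpne _ (by omega) _ (by omega) (by omega)⟩
        have h2 := Finset.card_le_card (Finset.inter_subset_left
          (s₁ := N (p (t + 1))) (s₂ := (Finset.range (l + 2)).image p))
        omega
    have hzl := hpz (l + 1) le_rfl
    have hzl' := hpz l (by omega)
    push_cast at hzl hzl'
    have hsum := h.sum_eq _ (hpos (l + 1) le_rfl)
    rw [← Finset.add_sum_erase _ _ (hpN l (by omega)), hzl, hzl'] at hsum
    have hce := Finset.card_erase_of_mem (hpN l (by omega))
    obtain ⟨k, hk⟩ : ∃ k, (N (p (l + 1))).erase (p l) = {k} := by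
      rw [← Finset.card_eq_one]
      have : 0 < ((N (p (l + 1))).erase (p l)).card := by
        rw [Finset.card_pos, Finset.nonempty_iff_ne_empty]
        intro he
        rw [he, Finset.sum_empty] at hsum
        nlinarith
      omega
    rw [hk, Finset.sum_singleton] at hsum
    have hkN : k ∈ N (p (l + 1)) :=
      Finset.mem_of_mem_erase (hk ▸ Finset.mem_singleton_self k : k ∈ (N (p (l + 1))).erase (p l))
    refine ⟨Function.update p (l + 2) k, by simp [hp0], by simp [hp1], fun t ht => ?_,
      fun t ht => ?_⟩
    · by_cases htl : t = l + 2
      · subst htl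
        rw [Function.update_self]
        push_cast
        linarith
      · rw [Function.update_of_ne htl]; exact hpz t (by omega)
    · rw [Function.update_of_ne (by omega : t ≠ l + 2)]
      by_cases htl : t = l + 1
      · subst htl; rw [Function.update_self]; exact h.mem_symm _ _ (hpos _ le_rfl) hkN
      · rw [Function.update_of_ne (by omega : t + 1 ≠ l + 2)]; exact hpN t (by omega)

theorem false_of_tree [DecidableEq V] (h : IsBadHarmonic B z N) {n : ℕ} (f : Fin (n + 1) → V)
    (par : Fin (n + 1) → Fin (n + 1))
    (c : Fin (n + 1) → ℤ) (hlt : ∀ s, s ≠ 0 → par s < s) (hc : ∀ s, 0 < c s ∧ c s ≤ 6)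
    (hform : ∑ s, c s ^ 2 - (∑ s, if s = 0 then 0 else c s * c (par s)) ≤ 0)
    (hmax : ∀ i, z i ≤ z (f 0)) (hpos : ∀ s, 0 < z (f s))
    (hN : ∀ s, s ≠ 0 → f (par s) ∈ N (f s)) (hz : ∀ s, s ≠ 0 → z (f s) < z (f (par s)))
    (hsib : ∀ s t, s ≠ 0 → t ≠ 0 → par s = par t → f s = f t → s = t) : False := by
  have hinj : Function.Injective f := by
    let N' : V → Finset V := fun i => if 0 < z i then N i else ∅
    refine tree_injective (N := N') (z := z) ?_ f par hlt hmax ?_ hz hsib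
    · intro i j hj k hk
      by_cases hi : 0 < z i
      · simp only [N', if_pos hi] at hj hk
        exact fun h1 h2 => h.larger_unique i j hj k hk h1 h2 hi
      · simp [N', if_neg hi] at hj
    · intro s hs
      simp only [N', if_pos (hpos s)]
      exact hN s hs
  have := tree_form_pos h.symm h.nonneg h.form_pos f hinj par
    (fun s hs => h.adj _ _ (hN s hs)) c (fun s => (hc s).1) (fun s => (hc s).2) hlt
  linarith

end IsBadHarmonic

namespace IsBadHarmonic

variable {z : V → ℤ} {N : V → Finset V}

theorem false_of_arms [DecidableEq V] (h : IsBadHarmonic B z N) {m : ℤ} (hm0 : 0 < m)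
    (hm : ∀ j, z j ≤ m) {a v₁ v₂ v₃ : V} (ha : z a = m) (h₁ : v₁ ∈ N a) (h₂ : v₂ ∈ N a)
    (h₃ : v₃ ∈ N a) (h₁₂ : v₁ ≠ v₂) (h₁₃ : v₁ ≠ v₃) (h₂₃ : v₂ ≠ v₃)
    (hsum : z v₁ + z v₂ + z v₃ = 2 * m) (hle₁ : z v₂ ≤ z v₁) (hle₂ : z v₃ ≤ z v₂) : False := by
  obtain ⟨d₁, hd₁⟩ : ∃ d, z v₁ = m - d := ⟨m - z v₁, by ring⟩
  obtain ⟨d₂, hd₂⟩ : ∃ d, z v₂ = m - d := ⟨m - z v₂, by ring⟩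
  obtain ⟨d₃, hd₃⟩ : ∃ d, z v₃ = m - d := ⟨m - z v₃, by ring⟩
  have hl₁ := h.lt_of_mem_of_max hm0 hm ha h₁
  have hp₃ := h.pos _ _ h₃
  have h₂₁ := h₁₂.symm
  have h₃₁ := h₁₃.symm
  have h₃₂ := h₂₃.symm
  by_cases hE6 : 2 * d₃ < m
  · obtain ⟨p, hp0, hp1, hpz, hpN⟩ := h.exists_arm hm0 hm ha h₁ hd₁ 1 (by push_cast; linarith)
    obtain ⟨q, hq0, hq1, hqz, hqN⟩ := h.exists_arm hm0 hm ha h₂ hd₂ 1 (by push_cast; linarith)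
    obtain ⟨r, hr0, hr1, hrz, hrN⟩ := h.exists_arm hm0 hm ha h₃ hd₃ 1 (by push_cast; linarith)
    have p2 := hpz 2 (by norm_num)
    have q2 := hqz 2 (by norm_num)
    have r2 := hrz 2 (by norm_num)
    have pN0 := hpN 0 (by norm_num)
    have pN1 := hpN 1 (by norm_num)
    have qN0 := hqN 0 (by norm_num)
    have qN1 := hqN 1 (by norm_num)
    have rN0 := hrN 0 (by norm_num)
    have rN1 := hrN 1 (by norm_num)
    simp only
        [hp0, hp1, hq0, hq1, hr0, hr1, zero_add, one_add_one_eq_two] at pN0 pN1 qN0 qN1 rN0 rN1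
    push_cast at p2 q2 r2
    refine h.false_of_tree ![a, v₁, p 2, v₂, q 2, v₃, r 2] ![0, 0, 1, 0, 3, 0, 5]
      ![3, 2, 1, 2, 1, 2, 1] (by decide) (by decide) (by decide) (by simpa [ha] using hm)
      ?_ ?_ ?_ ?_
    · intro s; fin_cases s <;> simp <;> linarith
    · intro s; fin_cases s <;> simp <;> assumption
    · intro s; fin_cases s <;> simp <;> linarith
    · intro s t; fin_cases s <;> fin_cases t <;> simp <;> assumption
  by_cases hE7 : 3 * d₂ < m
  · obtain ⟨p, hp0, hp1, hpz, hpN⟩ := h.exists_arm hm0 hm ha h₁ hd₁ 2 (by push_cast; linarith)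
    obtain ⟨q, hq0, hq1, hqz, hqN⟩ := h.exists_arm hm0 hm ha h₂ hd₂ 2 (by push_cast; linarith)
    obtain ⟨r, hr0, hr1, hrz, hrN⟩ := h.exists_arm hm0 hm ha h₃ hd₃ 0 (by push_cast; linarith)
    have p2 := hpz 2 (by norm_num)
    have p3 := hpz 3 (by norm_num)
    have q2 := hqz 2 (by norm_num)
    have q3 := hqz 3 (by norm_num)
    have pN0 := hpN 0 (by norm_num)
    have pN1 := hpN 1 (by norm_num)
    have pN2 := hpN 2 (by norm_num)
    have qN0 := hqN 0 (by norm_num)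
    have qN1 := hqN 1 (by norm_num)
    have qN2 := hqN 2 (by norm_num)
    have rN0 := hrN 0 (by norm_num)
    simp only [hp0, hp1, hq0, hq1, hr0, hr1, zero_add, one_add_one_eq_two, two_add_one_eq_three]
      at pN0 pN1 pN2 qN0 qN1 qN2 rN0
    push_cast at p2 q2 p3 q3
    refine h.false_of_tree ![a, v₁, p 2, p 3, v₂, q 2, q 3, v₃] ![0, 0, 1, 2, 0, 4, 5, 0]
      ![4, 3, 2, 1, 3, 2, 1, 2] (by decide) (by decide) (by decide) (by simpa [ha] using hm)
      ?_ ?_ ?_ ?_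
    · intro s; fin_cases s <;> simp <;> linarith
    · intro s; fin_cases s <;> simp <;> assumption
    · intro s; fin_cases s <;> simp <;> linarith
    · intro s t; fin_cases s <;> fin_cases t <;> simp <;> assumption
  · obtain ⟨p, hp0, hp1, hpz, hpN⟩ := h.exists_arm hm0 hm ha h₁ hd₁ 4 (by push_cast; linarith)
    obtain ⟨q, hq0, hq1, hqz, hqN⟩ := h.exists_arm hm0 hm ha h₂ hd₂ 1 (by push_cast; linarith)
    obtain ⟨r, hr0, hr1, hrz, hrN⟩ := h.exists_arm hm0 hm ha h₃ hd₃ 0 (by push_cast; linarith)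
    have p2 := hpz 2 (by norm_num)
    have p3 := hpz 3 (by norm_num)
    have p4 := hpz 4 (by norm_num)
    have p5 := hpz 5 (by norm_num)
    have q2 := hqz 2 (by norm_num)
    have pN0 := hpN 0 (by norm_num)
    have pN1 := hpN 1 (by norm_num)
    have pN2 := hpN 2 (by norm_num)
    have pN3 := hpN 3 (by norm_num)
    have pN4 := hpN 4 (by norm_num)
    have qN0 := hqN 0 (by norm_num)
    have qN1 := hqN 1 (by norm_num)
    have rN0 := hrN 0 (by norm_num)
    simp only [hp0, hp1, hq0, hq1, hr0, hr1, zero_add, one_add_one_eq_two, two_add_one_eq_three,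
      Nat.reduceAdd] at pN0 pN1 pN2 pN3 pN4 qN0 qN1 rN0
    push_cast at p2 q2 p3 p4 p5
    refine h.false_of_tree ![a, v₁, p 2, p 3, p 4, p 5, v₂, q 2, v₃] ![0, 0, 1, 2, 3, 4, 0, 6, 0]
      ![6, 5, 4, 3, 2, 1, 4, 2, 3] (by decide) (by decide) (by decide) (by simpa [ha] using hm)
      ?_ ?_ ?_ ?_
    · intro s; fin_cases s <;> simp <;> linarith
    · intro s; fin_cases s <;> simp <;> assumption
    · intro s; fin_cases s <;> simp <;> linarith
    · intro s t; fin_cases s <;> fin_cases t <;> simp <;> assumption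

theorem elim [DecidableEq V] (h : IsBadHarmonic B z N) (hz : ∃ i, 0 < z i) : False := by
  obtain ⟨i, hi⟩ := hz
  obtain ⟨a, -, hmax⟩ := Finset.exists_max_image Finset.univ z ⟨i, Finset.mem_univ i⟩
  have hm : ∀ j, z j ≤ z a := fun j => hmax j (Finset.mem_univ j)
  have hm0 : 0 < z a := hi.trans_le (hm i)
  have hc := h.card_eq_three hm0 hm rfl
  obtain ⟨u, v, w, huv, huw, hvw, hN⟩ := Finset.card_eq_three.1 hc
  have hs := h.sum_eq a hm0
  rw [hN, Finset.sum_insert (by simp [huv, huw]), Finset.sum_pair hvw] at hs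
  have hu : u ∈ N a := by simp [hN]
  have hv : v ∈ N a := by simp [hN]
  have hw : w ∈ N a := by simp [hN]
  have key := fun {v₁ v₂ v₃ : V} => h.false_of_arms hm0 hm rfl (v₁ := v₁) (v₂ := v₂) (v₃ := v₃)
  rcases le_total (z u) (z v) with h1 | h1 <;> rcases le_total (z v) (z w) with h2 | h2 <;>
    rcases le_total (z u) (z w) with h3 | h3
  · exact key hw hv hu hvw.symm huw.symm huv.symm (by linarith) h2 h1
  · exact key hw hv hu hvw.symm huw.symm huv.symm (by linarith) h2 h1
  · exact key hv hw hu hvw huv.symm huw.symm (by linarith) h2 h3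
  · exact key hv hu hw huv.symm hvw huw (by linarith) h1 h3
  · exact key hw hu hv huw.symm hvw.symm huv (by linarith) h3 h1
  · exact key hu hw hv huw huv hvw.symm (by linarith) h3 h2
  · exact key hu hv hw huv huw hvw (by linarith) h1 h2
  · exact key hu hv hw huv huw hvw (by linarith) h1 h2

end IsBadHarmonic

/-- If the Tits form of a graph is positive on all nonzero nonnegative vectors with coefficients at
most `6`, then it is weakly positive. -/
theorem pos_of_pos_of_le_six (hs : ∀ i j, B i j = B j i) (h0 : ∀ i j, 0 ≤ B i j)
    (hd : ∀ i, B i i = 0) (hev : ∀ z, Even (titsForm B z))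
    (H : ∀ w : V → ℤ, 0 ≤ w → (∀ i, w i ≤ 6) → w ≠ 0 → 0 < titsForm B w)
    (z : V → ℤ) (hz : 0 ≤ z) (hz0 : z ≠ 0) : 0 < titsForm B z := by
  classical
  by_contra hcon
  obtain ⟨z, hz, hz0, hh⟩ := exists_harmonic hs hd hev H ⟨z, hz, hz0, not_lt.1 hcon⟩
  have h1 := adj_le_one hs hd H
  have hbad : IsBadHarmonic B z (fun i => Finset.univ.filter fun j => 0 < z j ∧ 1 ≤ B i j) := by
    refine ⟨hs, h0, H, ?_, ?_, ?_, ?_⟩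
    · intro i j hj
      exact (Finset.mem_filter.1 hj).2.2
    · intro i j hi hj
      exact Finset.mem_filter.2 ⟨Finset.mem_univ _, hi, hs i j ▸ (Finset.mem_filter.1 hj).2.2⟩
    · intro i j hj
      exact (Finset.mem_filter.1 hj).2.1
    · intro i hi
      rw [← hh i hi, Finset.sum_filter]
      refine Finset.sum_congr rfl fun j _ => ?_
      have hj := hz j
      simp only [Pi.zero_apply] at hj
      split_ifs with hc
      · rw [le_antisymm (h1 i j) hc.2, one_mul]
      · rcases hj.eq_or_lt with hj | hj
        · rw [← hj, mul_zero]
        · have : B i j = 0 := by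
            have := h0 i j
            have : ¬ 1 ≤ B i j := fun hB => hc ⟨hj, hB⟩
            omega
          rw [this, zero_mul]
  refine hbad.elim ?_
  by_contra! hneg
  exact hz0 (le_antisymm hneg hz)

theorem add_eq (hs : ∀ i j, B i j = B j i) (z w : V → ℤ) :
    titsForm B (z + w) =
      titsForm B z + titsForm B w + 2 * ∑ i, w i * (2 * z i - ∑ j, B i j * z j) := by
  have h : ∑ i, w i * ∑ j, B i j * z j = ∑ i, z i * ∑ j, B i j * w j := by
    simp only [Finset.mul_sum]
    rw [Finset.sum_comm]
    exact Finset.sum_congr rfl fun i _ ↦ Finset.sum_congr rfl fun j _ ↦ by rw [hs]; ring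
  have h' : ∑ i, w i * (2 * z i - ∑ j, B i j * z j) =
      ∑ i, z i * (2 * w i - ∑ j, B i j * w j) := by
    simp only [mul_sub, Finset.sum_sub_distrib, h]
    congr 1
    exact Finset.sum_congr rfl fun i _ ↦ by ring
  rw [two_mul]
  nth_rw 1 [h']
  simp only [titsForm, ← Finset.sum_add_distrib, Pi.add_apply]
  refine Finset.sum_congr rfl fun i _ ↦ ?_
  simp only [mul_add, Finset.sum_add_distrib]
  ring

theorem finite_setOf_eq (hs : ∀ i j, B i j = B j i) (h0 : ∀ i j, 0 ≤ B i j)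
    (hd : ∀ i, B i i = 0)
    (hpos : ∀ z : V → ℤ, 0 ≤ z → z ≠ 0 → 0 < titsForm B z) (h : ℤ) :
    {d : V → ℕ | titsForm B (fun v ↦ (d v : ℤ)) = h}.Finite := by
  classical
  have hnn : ∀ z : V → ℤ, 0 ≤ z → 0 ≤ titsForm B z := fun z hz ↦ by
    by_cases hz0 : z = 0
    · simp [hz0, titsForm]
    · exact (hpos z hz hz0).le
  let g : (V → ℕ) → V → ℤ := fun d i ↦ 2 * (d i : ℤ) - ∑ j, B i j * (d j : ℤ)
  have hsingle (i : V) : titsForm B (Pi.single i 1) = 2 := by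
    rw [titsForm, Finset.sum_eq_single i]
    · simp [Pi.single_apply, hd]
    · intro j _ hj; simp [hj]
    · simp
  have hsum (c : ℤ) (i : V) (z : V → ℤ) : ∑ j,
      (c • Pi.single i (1 : ℤ) : V → ℤ) j * z j = c * z i := by
    simp [Pi.single_apply]
  refine Set.Finite.of_finite_fibers g
      ((Set.finite_Icc (fun _ ↦ -(h + 2)) (fun _ ↦ h + 2)).subset ?_) ?_
  · rintro _ ⟨d, hd', rfl⟩
    rw [Set.mem_ofPred_eq] at hd'
    have hh : 0 ≤ h := hd' ▸ hnn _ fun v ↦ by simp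
    refine ⟨fun i ↦ ?_, fun i ↦ ?_⟩
    · have := hnn ((fun v ↦ (d v : ℤ)) + (1 : ℤ) • Pi.single i 1)
        (add_nonneg (fun v ↦ by simp) (by simp))
      rw [add_eq hs, hsum, one_smul, hsingle, hd'] at this
      simp only [g]
      linarith
    · by_cases hi : d i = 0
      · have : 0 ≤ ∑ j, B i j * (d j : ℤ) :=
          Finset.sum_nonneg fun j _ ↦ mul_nonneg (h0 i j) (by simp)
        simp only [g, hi]
        push_cast
        linarith
      · have hn : 0 ≤ (fun v ↦ (d v : ℤ)) + (-1 : ℤ) • Pi.single i (1 : ℤ) := fun v ↦ by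
          by_cases hv : v = i
          · subst hv; simp; omega
          · simp [hv]
        have := hnn _ hn
        have h2 : titsForm B ((-1 : ℤ) • Pi.single i (1 : ℤ)) = 2 := by
          rw [← hsingle i]
          simp only [titsForm, neg_smul, one_smul, Pi.neg_apply, mul_neg, Finset.sum_neg_distrib]
          exact Finset.sum_congr rfl fun j _ ↦ by ring
        rw [add_eq hs, hsum, h2, hd'] at this
        simp only [g]
        linarith
  · rintro _ ⟨d₀, -, rfl⟩
    have hanti : IsAntichain (· ≤ ·)
        ({d : V → ℕ | titsForm B (fun v ↦ (d v : ℤ)) = h} ∩ g ⁻¹' {g d₀}) := by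
      rintro d ⟨hd1, hd2⟩ d' ⟨hd1', hd2'⟩ hne hle
      have hg : g d = g d' := hd2.trans hd2'.symm
      have hz := hpos (fun v ↦ (d' v : ℤ) - d v) (fun v ↦ by simpa using hle v) (fun h ↦ hne <| by
        funext v
        have := congrFun h v
        simp only [Pi.zero_apply] at this
        omega)
      refine hz.ne' (Finset.sum_eq_zero fun i _ ↦ ?_)
      have := congrFun hg i
      simp only [g] at this
      rw [mul_eq_zero]
      right
      simp only [mul_sub, Finset.sum_sub_distrib]
      linarith
    exact WellQuasiOrderedLE.finite_of_isAntichain hanti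

end titsForm

section Bipartite

variable {I J : Type*} [Fintype I] [Fintype J]

/-- The Tits form `∑ xᵢ² + ∑ yⱼ² - ∑ bᵢⱼ xᵢ yⱼ` of the bipartite quiver with `b i j` arrows
from `i` to `j`. -/
def bipartiteForm (b : I → J → ℕ) (x : I → ℤ) (y : J → ℤ) : ℤ :=
  ∑ i, x i ^ 2 + ∑ j, y j ^ 2 - ∑ i, ∑ j, b i j * (x i * y j)

/-- The adjacency matrix of the underlying graph of a bipartite quiver. -/
def bipartiteAdj (b : I → J → ℕ) : I ⊕ J → I ⊕ J → ℤ
  | .inl i, .inr j => b i j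
  | .inr j, .inl i => b i j
  | _, _ => 0

namespace bipartiteForm

variable {b : I → J → ℕ}

theorem titsForm_adj (z : I ⊕ J → ℤ) :
    titsForm (bipartiteAdj b) z = 2 * bipartiteForm b (z ∘ Sum.inl) (z ∘ Sum.inr) := by
  rw [titsForm.eq_sub, bipartiteForm]
  simp only [Fintype.sum_sum_type, bipartiteAdj, zero_mul, Finset.sum_const_zero, zero_add,
    add_zero, Function.comp_apply]
  have : ∑ j, ∑ i, (b i j : ℤ) * (z (.inr j) * z (.inl i)) =
      ∑ i, ∑ j, (b i j : ℤ) * (z (.inl i) * z (.inr j)) := by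
    rw [Finset.sum_comm]
    exact Finset.sum_congr rfl fun i _ ↦ Finset.sum_congr rfl fun j _ ↦ by ring
  rw [this]
  ring

theorem pos_of_pos_of_le_six
    (H : ∀ (x : I → ℕ) (y : J → ℕ), (∀ i, x i ≤ 6) → (∀ j, y j ≤ 6) → (x ≠ 0 ∨ y ≠ 0) →
      0 < bipartiteForm b (fun i ↦ x i) (fun j ↦ y j))
    (x : I → ℤ) (y : J → ℤ) (hx : 0 ≤ x) (hy : 0 ≤ y) (h : x ≠ 0 ∨ y ≠ 0) :
    0 < bipartiteForm b x y := by
  have := titsForm.pos_of_pos_of_le_six (B := bipartiteAdj b) (by rintro (i | i) (j | j) <;> rfl)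
    (by rintro (i | i) (j | j) <;> simp [bipartiteAdj])
    (by rintro (i | i) <;> simp [bipartiteAdj])
    (fun z ↦ by rw [titsForm_adj]; simp)
    (fun w hw hw6 hw0 ↦ by
      rw [titsForm_adj]
      have := H (fun i ↦ (w (.inl i)).toNat) (fun i ↦ (w (.inr i)).toNat)
        (fun i ↦ by simpa using hw6 (.inl i)) (fun i ↦ by simpa using hw6 (.inr i)) (by
          contrapose! hw0
          funext v
          have hv := hw v
          rcases v with i | j
          · have := congrFun hw0.1 i; simp only [Pi.zero_apply] at this hv ⊢; omega
          · have := congrFun hw0.2 j; simp only [Pi.zero_apply] at this hv ⊢; omega)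
      simp only [Int.toNat_of_nonneg (hw _)] at this
      exact mul_pos two_pos this)
    (Sum.elim x y) (by rintro (i | j); exacts [hx i, hy j])
    (by
      contrapose! h
      exact ⟨funext fun i ↦ congrFun h (.inl i), funext fun j ↦ congrFun h (.inr j)⟩)
  rw [titsForm_adj] at this
  exact (mul_pos_iff_of_pos_left two_pos).1 this

/-- Weak positivity of the Tits form of a bipartite quiver. -/
def _root_.IsWeaklyPositive (b : I → J → ℕ) : Prop :=
  ∀ (x : I → ℕ) (y : J → ℕ), (x ≠ 0 ∨ y ≠ 0) →
    0 < bipartiteForm b (fun i ↦ x i) (fun j ↦ y j)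

theorem finite_setOf_eq (hb : IsWeaklyPositive b) (h : ℤ) :
    {d : (I → ℕ) × (J → ℕ) | bipartiteForm b (fun i ↦ d.1 i) (fun j ↦ d.2 j) = h}.Finite := by
  have := titsForm.finite_setOf_eq (B := bipartiteAdj b) (by rintro (i | i) (j | j) <;> rfl)
    (by rintro (i | i) (j | j) <;> simp [bipartiteAdj])
    (by rintro (i | i) <;> simp [bipartiteAdj])
    (fun w hw hw0 ↦ by
      rw [titsForm_adj]
      have := hb (fun i ↦ (w (.inl i)).toNat) (fun i ↦ (w (.inr i)).toNat) (by
          contrapose! hw0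
          funext v
          have hv := hw v
          rcases v with i | j
          · have := congrFun hw0.1 i; simp only [Pi.zero_apply] at this hv ⊢; omega
          · have := congrFun hw0.2 j; simp only [Pi.zero_apply] at this hv ⊢; omega)
      simp only [Int.toNat_of_nonneg (hw _)] at this
      exact mul_pos two_pos this) (2 * h)
  refine (this.image fun d ↦ (d ∘ Sum.inl, d ∘ Sum.inr)).subset fun d hd ↦
    ⟨Sum.elim d.1 d.2, ?_, rfl⟩
  rw [Set.mem_ofPred_eq] at hd ⊢
  rw [titsForm_adj, ← hd]
  rfl

theorem swap (b : I → J → ℕ) (x : I → ℤ) (y : J → ℤ) :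
    bipartiteForm (fun j i ↦ b i j) y x = bipartiteForm b x y := by
  rw [bipartiteForm, bipartiteForm, Finset.sum_comm, add_comm]
  congr 1
  exact Finset.sum_congr rfl fun i _ ↦ Finset.sum_congr rfl fun j _ ↦ by ring

theorem reflect (x : I → ℤ) (y : J → ℤ) :
    bipartiteForm b x (fun j ↦ ∑ i, b i j * x i - y j) = bipartiteForm b x y := by
  have (y : J → ℤ) : ∑ i, ∑ j, (b i j : ℤ) * (x i * y j) = ∑ j, (∑ i, b i j * x i) * y j := by
    rw [Finset.sum_comm]
    refine Finset.sum_congr rfl fun j _ ↦ ?_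
    rw [Finset.sum_mul]
    exact Finset.sum_congr rfl fun i _ ↦ by ring
  simp only [bipartiteForm, this, add_sub_assoc, ← Finset.sum_sub_distrib]
  congr 1
  exact Finset.sum_congr rfl fun j _ ↦ by ring

/-- A weakly positive form admits no infinite sequence of alternating reflections staying in the
positive cone. -/
theorem false_of_reflections (hb : IsWeaklyPositive b) (x : ℕ → I → ℕ) (y : ℕ → J → ℕ)
    (h0 : ∀ n, x n ≠ 0 ∨ y n ≠ 0)
    (hy : ∀ n j, y (n + 1) j + y n j = ∑ i, b i j * x n i)
    (hx : ∀ n i, x (n + 1) i + x n i = ∑ j, b i j * y (n + 1) j) : False := by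
  let Q : ℕ → ℤ := fun n ↦ bipartiteForm b (fun i ↦ x n i) (fun j ↦ y n j)
  have hQ (n) : Q (n + 1) = Q n := by
    have h1 := reflect (b := b) (fun i ↦ x n i) (fun j ↦ y n j)
    have h2 := reflect (b := fun j i ↦ b i j) (fun j ↦ y (n + 1) j) (fun i ↦ x n i)
    rw [swap b, swap b] at h2
    have e1 : (fun j ↦ ∑ i, (b i j : ℤ) * (x n i : ℤ) - y n j) = fun j ↦ (y (n + 1) j : ℤ) := by
      funext j; have := hy n j; zify at this; linarith
    have e2 : (fun i ↦ ∑ j, (b i j : ℤ) * (y (n + 1) j : ℤ) - x n i) =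
        fun i ↦ (x (n + 1) i : ℤ) := by
      funext j; have := hx n j; zify at this; linarith
    rw [e1] at h1
    rw [e2] at h2
    exact h2.trans h1
  have hQ0 (n) : Q n = Q 0 := by
    induction n with
    | zero => rfl
    | succ n ih => rw [hQ, ih]
  obtain ⟨n, m, hnm, he⟩ : ∃ n m, n < m ∧ (x n, y n) = (x m, y m) := by
    have := (finite_setOf_eq hb (Q 0)).to_subtype
    obtain ⟨n, m, hne, he⟩ := Finite.exists_ne_map_eq_of_infinite
      (fun n ↦ (⟨(x n, y n), hQ0 n⟩ : {d : (I → ℕ) × (J → ℕ) |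
        bipartiteForm b (fun i ↦ d.1 i) (fun j ↦ d.2 j) = Q 0}))
    rcases hne.lt_or_gt with h | h
    · exact ⟨n, m, h, congrArg Subtype.val he⟩
    · exact ⟨m, n, h, (congrArg Subtype.val he).symm⟩
  obtain ⟨hxe, hye⟩ := Prod.mk.inj he
  let U : I → ℕ := fun i ↦ ∑ t ∈ Finset.Ico n m, x t i
  let W : J → ℕ := fun j ↦ ∑ t ∈ Finset.Ico n m, y t j
  have shift (f : ℕ → ℕ) (hf : f n = f m) :
      ∑ t ∈ Finset.Ico n m, f (t + 1) = ∑ t ∈ Finset.Ico n m, f t := by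
    have h1 := Finset.sum_Ico_add' f n m 1
    have h2 := Finset.sum_eq_sum_Ico_succ_bot hnm f
    have h3 := Finset.sum_Ico_succ_top (a := n + 1) (b := m) (by omega) f
    omega
  have hW (j) : 2 * W j = ∑ i, b i j * U i := by
    simp only [U, W, Finset.mul_sum]
    rw [Finset.sum_comm]
    simp only [← hy, Finset.sum_add_distrib]
    rw [shift (fun t ↦ y t j) (congrFun hye j), ← Finset.mul_sum]
    ring
  have hU (i) : 2 * U i = ∑ j, b i j * W j := by
    have hW' : W = fun j ↦ ∑ t ∈ Finset.Ico n m, y (t + 1) j := by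
      funext j; exact (shift _ (congrFun hye j)).symm
    rw [hW']
    simp only [U, Finset.mul_sum]
    rw [Finset.sum_comm]
    simp only [← hx, Finset.sum_add_distrib]
    rw [shift (fun t ↦ x t i) (congrFun hxe i), ← Finset.mul_sum]
    ring
  have hpos := hb U W (by
    have hn : n ∈ Finset.Ico n m := by simp [hnm]
    refine (h0 n).imp (fun h h' ↦ h ?_) (fun h h' ↦ h ?_)
    · funext i
      exact (Finset.sum_eq_zero_iff.1 (congrFun h' i)) n hn
    · funext i
      exact (Finset.sum_eq_zero_iff.1 (congrFun h' i)) n hn)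
  refine hpos.ne' ?_
  have e1 : ∑ i, ∑ j, (b i j : ℤ) * (U i * W j) = ∑ i, 2 * (U i : ℤ) ^ 2 := by
    refine Finset.sum_congr rfl fun i _ ↦ ?_
    have := hU i
    zify at this
    rw [sq, ← mul_assoc, this, Finset.sum_mul]
    exact Finset.sum_congr rfl fun i _ ↦ by ring
  have e2 : ∑ i, ∑ j, (b i j : ℤ) * (U i * W j) = ∑ j, 2 * (W j : ℤ) ^ 2 := by
    rw [Finset.sum_comm]
    refine Finset.sum_congr rfl fun i _ ↦ ?_
    have := hW i
    zify at this
    rw [sq, ← mul_assoc, this, Finset.sum_mul]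
    exact Finset.sum_congr rfl fun i _ ↦ by ring
  rw [← Finset.mul_sum] at e1 e2
  rw [bipartiteForm]
  linarith

end bipartiteForm

end Bipartite

/-- A finite-dimensional representation of the bipartite quiver with arrows `α i j` from `i`
to `j`. -/
structure BipartiteRep (k : Type) [Field k] {I J : Type} (α : I → J → Type) where
  /-- The spaces at the sources. -/
  X : I → Type
  /-- The spaces at the sinks. -/
  Y : J → Type
  [instX : ∀ i, AddCommGroup (X i)]
  [instY : ∀ j, AddCommGroup (Y j)]
  [modX : ∀ i, Module k (X i)]
  [modY : ∀ j, Module k (Y j)]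
  [finX : ∀ i, FiniteDimensional k (X i)]
  [finY : ∀ j, FiniteDimensional k (Y j)]
  /-- The maps along the arrows. -/
  φ : ∀ i j, α i j → X i →ₗ[k] Y j

attribute [instance] BipartiteRep.instX BipartiteRep.instY BipartiteRep.modX BipartiteRep.modY
  BipartiteRep.finX BipartiteRep.finY

namespace BipartiteRep

variable {k : Type} [Field k] {I J : Type} {α : I → J → Type}

/-- Isomorphism of representations. -/
def Iso (M N : BipartiteRep k α) : Prop :=
  ∃ (F : ∀ i, M.X i ≃ₗ[k] N.X i) (G : ∀ j, M.Y j ≃ₗ[k] N.Y j),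
    ∀ i j a x, G j (M.φ i j a x) = N.φ i j a (F i x)

/-- Indecomposability of a representation. -/
structure Indecomposable (M : BipartiteRep k α) : Prop where
  nonzero : ¬ ((∀ i, Subsingleton (M.X i)) ∧ ∀ j, Subsingleton (M.Y j))
  eq_bot : ∀ (X₁ X₂ : ∀ i, Submodule k (M.X i)) (Y₁ Y₂ : ∀ j, Submodule k (M.Y j)),
    (∀ i, IsCompl (X₁ i) (X₂ i)) → (∀ j, IsCompl (Y₁ j) (Y₂ j)) →
    (∀ i j a, ∀ x ∈ X₁ i, M.φ i j a x ∈ Y₁ j) → (∀ i j a, ∀ x ∈ X₂ i, M.φ i j a x ∈ Y₂ j) →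
    ((∀ i, X₁ i = ⊥) ∧ ∀ j, Y₁ j = ⊥) ∨ ((∀ i, X₂ i = ⊥) ∧ ∀ j, Y₂ j = ⊥)

theorem Indecomposable.dim_ne_zero {M : BipartiteRep k α} (hM : M.Indecomposable) :
    (fun i ↦ Module.finrank k (M.X i)) ≠ 0 ∨ (fun j ↦ Module.finrank k (M.Y j)) ≠ 0 := by
  have := hM.nonzero
  contrapose! this
  exact ⟨fun i ↦ Module.finrank_zero_iff.1 (congrFun this.1 i),
    fun j ↦ Module.finrank_zero_iff.1 (congrFun this.2 j)⟩

variable [∀ i j, Fintype (α i j)] [Fintype I]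

/-- The sum of all arrow maps into the sink `j`. -/
def total (M : BipartiteRep k α) (j : J) : (∀ p : Σ i, α i j, M.X p.1) →ₗ[k] M.Y j :=
  ∑ p : Σ i, α i j, M.φ p.1 j p.2 ∘ₗ LinearMap.proj p

theorem total_apply (M : BipartiteRep k α) (j : J) (f : ∀ p : Σ i, α i j, M.X p.1) :
    M.total j f = ∑ p : Σ i, α i j, M.φ p.1 j p.2 (f p) := by
  simp [total]

theorem total_single [DecidableEq I] [∀ i j, DecidableEq (α i j)] (M : BipartiteRep k α) (i : I)
    (j : J) (a : α i j) (x : M.X i) :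
    M.total j (Pi.single (M := fun p : Σ i, α i j ↦ M.X p.1) ⟨i, a⟩ x) = M.φ i j a x := by
  rw [total_apply, Finset.sum_eq_single ⟨i, a⟩]
  · simp
  · intro p _ hp
    rw [Pi.single_eq_of_ne hp, map_zero]
  · simp

/-- The reflection of a representation at all sinks. -/
def reflect (M : BipartiteRep k α) : BipartiteRep k (fun j i ↦ α i j) where
  X j := LinearMap.ker (M.total j)
  Y i := M.X i
  φ j i a := LinearMap.proj (φ := fun p : Σ i, α i j ↦ M.X p.1) ⟨i, a⟩ ∘ₗ Submodule.subtype _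

theorem finrank_reflect (M : BipartiteRep k α) (h : ∀ j, Function.Surjective (M.total j)) (j : J) :
    Module.finrank k (M.reflect.X j) + Module.finrank k (M.Y j) =
      ∑ i, Fintype.card (α i j) * Module.finrank k (M.X i) := by
  have h1 := LinearMap.finrank_range_add_finrank_ker (M.total j)
  rw [LinearMap.range_eq_top.2 (h j), finrank_top, Module.finrank_pi_fintype,
    Fintype.sum_sigma] at h1
  rw [add_comm]
  refine h1.trans (Finset.sum_congr rfl fun i _ ↦ ?_)
  exact Finset.sum_const (s := (Finset.univ : Finset (α i j))) (Module.finrank k (M.X i))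

theorem Indecomposable.surjective_or_simple [DecidableEq J] {M : BipartiteRep k α}
    (hM : M.Indecomposable) :
    (∀ j, Function.Surjective (M.total j)) ∨
      (∀ i, Module.finrank k (M.X i) = 0) ∧
        ∃ j, ∀ j', Module.finrank k (M.Y j') = (Pi.single j 1 : J → ℕ) j' := by
  classical
  by_contra! h
  obtain ⟨⟨j, hj⟩, h⟩ := h
  obtain ⟨v, hv⟩ : ∃ v, v ∉ LinearMap.range (M.total j) := by
    contrapose! hj
    exact fun v ↦ hj v
  have hv0 : v ≠ 0 := fun h ↦ hv (h ▸ zero_mem _)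
  obtain ⟨W, hW, hWv⟩ := Disjoint.exists_isCompl
    (((Submodule.disjoint_span_singleton' hv0).2 hv))
  have hdep := hM.eq_bot (fun _ ↦ ⊤) (fun _ ↦ ⊥) (Function.update (fun _ ↦ ⊤) j W)
    (Function.update (fun _ ↦ ⊥) j (k ∙ v)) (fun _ ↦ isCompl_top_bot)
    (fun j' ↦ by
      rcases eq_or_ne j' j with rfl | hj'
      · simpa using hWv
      · simpa [hj'] using isCompl_top_bot)
    (fun i j' a x _ ↦ by
      rcases eq_or_ne j' j with rfl | hj'
      · rw [Function.update_self]
        exact hW ⟨_, M.total_single i j' a x⟩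
      · simp [hj'])
    (fun i j' a x hx ↦ by
      rw [Submodule.mem_bot] at hx
      simp [hx])
  rcases hdep with ⟨h1, h2⟩ | ⟨-, h2⟩
  · obtain ⟨j', hj'⟩ := h (fun i ↦ by rw [← finrank_top, h1 i, finrank_bot]) j
    apply hj'
    have h3 := h2 j'
    rcases eq_or_ne j' j with rfl | hne
    · rw [Function.update_self] at h3
      rw [h3] at hWv
      rw [Pi.single_eq_same, ← finrank_span_singleton (K := k) hv0, eq_top_of_bot_isCompl hWv,
        finrank_top]
    · rw [Function.update_of_ne hne] at h3
      rw [Pi.single_eq_of_ne hne, ← finrank_top, h3, finrank_bot]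
  · have := h2 j
    simp [hv0] at this

theorem Indecomposable.reflect {M : BipartiteRep k α} (hM : M.Indecomposable)
    (h : ∀ j, Function.Surjective (M.total j)) : M.reflect.Indecomposable where
  nonzero := by
    rintro ⟨-, h2⟩
    refine hM.nonzero ⟨h2, fun j ↦ ?_⟩
    have (p : Σ i, α i j) : Subsingleton (M.X p.1) := h2 p.1
    exact (h j).subsingleton
  eq_bot A₁ A₂ B₁ B₂ hA hB h₁ h₂ := by
    classical
    let S (B : ∀ i, Submodule k (M.X i)) (j : J) : Submodule k (∀ p : Σ i, α i j, M.X p.1) :=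
      Submodule.pi Set.univ fun p ↦ B p.1
    have hS (B) (i j) (a : α i j) (x) (hx : x ∈ B i) : M.φ i j a x ∈ (S B j).map (M.total j) := by
      refine ⟨_, ?_, M.total_single i j a x⟩
      rintro p -
      by_cases hp : p = ⟨i, a⟩
      · subst hp; simpa using hx
      · rw [Pi.single_eq_of_ne hp]; exact zero_mem _
    have key : ∀ (B : ∀ i, Submodule k (M.X i)) (A : ∀ j, Submodule k (M.reflect.X j)),
        (∀ j i a, ∀ x ∈ A j, M.reflect.φ j i a x ∈ B i) → (∀ i, B i = ⊥) → ∀ j, A j = ⊥ := by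
      intro B A hAB hB j
      rw [Submodule.eq_bot_iff]
      rintro ⟨f, hf⟩ hfA
      apply Subtype.ext
      funext p
      have := hAB j p.1 p.2 _ hfA
      rw [hB] at this
      exact this
    refine (hM.eq_bot B₁ B₂ (fun j ↦ (S B₁ j).map (M.total j)) (fun j ↦ (S B₂ j).map (M.total j))
      hB (fun j ↦ ⟨?_, ?_⟩) (hS B₁) (hS B₂)).imp (fun h ↦ ⟨key _ _ h₁ h.1, h.1⟩)
      (fun h ↦ ⟨key _ _ h₂ h.1, h.1⟩)
    · rw [Submodule.disjoint_def]
      rintro _ ⟨f₁, hf₁, rfl⟩ ⟨f₂, hf₂, he⟩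
      obtain ⟨a₁, ha₁, a₂, ha₂, hsum⟩ := Submodule.mem_sup.1
        ((hA j).sup_eq_top.ge (Submodule.mem_top (x := (⟨f₁ - f₂, by simp [he]⟩ :
          LinearMap.ker (M.total j)))))
      have : f₁ = a₁.1 := by
        funext p
        have e := congrFun (congrArg Subtype.val hsum) p
        have e' : f₁ p - a₁.1 p = f₂ p + a₂.1 p := by
          change a₁.1 p + a₂.1 p = f₁ p - f₂ p at e
          rw [sub_eq_iff_eq_add, add_assoc, add_comm (a₂.1 p), e]; abel
        have m1 : f₁ p - a₁.1 p ∈ B₁ p.1 := sub_mem (hf₁ p trivial) (h₁ j p.1 p.2 a₁ ha₁)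
        have m2 : f₁ p - a₁.1 p ∈ B₂ p.1 := e' ▸ add_mem (hf₂ p trivial) (h₂ j p.1 p.2 a₂ ha₂)
        exact sub_eq_zero.1 (Submodule.disjoint_def.1 (hB p.1).disjoint _ m1 m2)
      rw [this]
      exact a₁.2
    · rw [codisjoint_iff, ← Submodule.map_sup, eq_top_iff]
      intro y _
      obtain ⟨f, rfl⟩ := h j y
      have (p : Σ i, α i j) := Submodule.mem_sup.1
        ((hB p.1).sup_eq_top.ge (Submodule.mem_top (x := f p)))
      choose f₁ hf₁ f₂ hf₂ hf using this
      refine ⟨f, ?_, rfl⟩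
      rw [← funext hf]
      exact Submodule.add_mem_sup (fun p _ ↦ hf₁ p) (fun p _ ↦ hf₂ p)

theorem Iso.of_reflect {M N : BipartiteRep k α} (hM : ∀ j, Function.Surjective (M.total j))
    (hN : ∀ j, Function.Surjective (N.total j)) (h : Iso M.reflect N.reflect) : Iso M N := by
  classical
  obtain ⟨F, G, hFG⟩ := h
  let G' : ∀ i, M.X i ≃ₗ[k] N.X i := G
  let E (j : J) : (∀ p : Σ i, α i j, M.X p.1) ≃ₗ[k] (∀ p : Σ i, α i j, N.X p.1) :=
    LinearEquiv.piCongrRight fun p ↦ G' p.1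
  have hE (j) (f : LinearMap.ker (M.total j)) : E j f.1 = (F j f).1 := by
    funext p
    exact hFG j p.1 p.2 f
  have hmap (j) : (LinearMap.ker (M.total j)).map (E j : _ →ₗ[k] _) = LinearMap.ker
      (N.total j) := by
    apply le_antisymm
    · rintro _ ⟨f, hf, rfl⟩
      have := hE j ⟨f, hf⟩
      exact Set.mem_of_eq_of_mem this (F j ⟨f, hf⟩).2
    · intro f hf
      refine ⟨((F j).symm ⟨f, hf⟩).1, ((F j).symm ⟨f, hf⟩).2, ?_⟩
      exact (hE j _).trans (congrArg Subtype.val ((F j).apply_symm_apply ⟨f, hf⟩))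
  let H (j : J) : M.Y j ≃ₗ[k] N.Y j := ((M.total j).quotKerEquivOfSurjective (hM j)).symm ≪≫ₗ
    Submodule.Quotient.equiv _ _ (E j) (hmap j) ≪≫ₗ (N.total j).quotKerEquivOfSurjective (hN j)
  have hH (j) (f) : H j (M.total j f) = N.total j (E j f) := by
    have : ((M.total j).quotKerEquivOfSurjective (hM j)).symm (M.total j f) =
        Submodule.Quotient.mk f := by
      rw [LinearEquiv.symm_apply_eq, LinearMap.quotKerEquivOfSurjective_apply_mk]
    simp only [H, LinearEquiv.trans_apply, this, Submodule.Quotient.equiv_apply,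
      Submodule.mapQ_apply, LinearMap.quotKerEquivOfSurjective_apply_mk, LinearEquiv.coe_coe]
  refine ⟨G', H, fun i j a x ↦ ?_⟩
  rw [← M.total_single, ← N.total_single, hH]
  congr 1
  funext p
  simp only [E, LinearEquiv.piCongrRight_apply]
  rcases eq_or_ne p ⟨i, a⟩ with rfl | hp
  · simp
  · rw [Pi.single_eq_of_ne hp, Pi.single_eq_of_ne hp, map_zero]

section DimensionVectors

variable [Fintype J]

/-- A dimension vector violating the conclusion of Gabriel's theorem: it belongs to an
indecomposable representation, but it is not a root of the Tits form or it belongs to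
non-isomorphic indecomposable representations. -/
def IsExceptionalDim (k : Type) [Field k] (α : I → J → Type) [∀ i j, Fintype (α i j)] (x : I → ℕ)
    (y : J → ℕ) : Prop :=
  ∃ M : BipartiteRep k α, M.Indecomposable ∧ (∀ i, Module.finrank k (M.X i) = x i) ∧
    (∀ j, Module.finrank k (M.Y j) = y j) ∧
    (bipartiteForm (fun i j ↦ Fintype.card (α i j)) (fun i ↦ x i) (fun j ↦ y j) ≠ 1 ∨
      ∃ N : BipartiteRep k α, N.Indecomposable ∧ (∀ i, Module.finrank k (N.X i) = x i) ∧
        (∀ j, Module.finrank k (N.Y j) = y j) ∧ ¬ Iso M N)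

theorem IsExceptionalDim.ne_simple [DecidableEq J] {x : I → ℕ} {y : J → ℕ}
    (h : IsExceptionalDim k α x y) : ¬
        ((∀ i, x i = 0) ∧ ∃ j, ∀ j', y j' = (Pi.single j 1 : J → ℕ) j') := by
  rintro ⟨hx, j, hy⟩
  obtain ⟨M, -, hMx, hMy, h | ⟨N, -, hNx, hNy, h⟩⟩ := h
  · apply h
    simp only [bipartiteForm, hx, hy]
    simp [Pi.single_apply]
  · have (i : I) : Subsingleton (M.X i) := Module.finrank_zero_iff.1 ((hMx i).trans (hx i))
    have (i : I) : Subsingleton (N.X i) := Module.finrank_zero_iff.1 ((hNx i).trans (hx i))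
    refine h ⟨fun i ↦ LinearEquiv.ofFinrankEq _ _ ((hMx i).trans (hNx i).symm),
      fun j ↦ LinearEquiv.ofFinrankEq _ _ ((hMy j).trans (hNy j).symm), fun i j a x ↦ ?_⟩
    rw [Subsingleton.elim x 0]
    simp

theorem IsExceptionalDim.exists_reflect {x : I → ℕ} {y : J → ℕ} (h : IsExceptionalDim k α x y) :
    ∃ y' : J → ℕ, (∀ j, y' j + y j = ∑ i, Fintype.card (α i j) * x i) ∧
      IsExceptionalDim k (fun j i ↦ α i j) y' x := by
  classical
  have hs := h.ne_simple
  obtain ⟨M, hM, hMx, hMy, h⟩ := h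
  have key {N : BipartiteRep k α} (hN : N.Indecomposable)
      (hNx : ∀ i, Module.finrank k (N.X i) = x i) (hNy : ∀ j, Module.finrank k (N.Y j) = y j) :
      (∀ j, Function.Surjective (N.total j)) ∧
        ∀ j, Module.finrank k (N.reflect.X j) + y j = ∑ i, Fintype.card (α i j) * x i := by
    have hT := hN.surjective_or_simple.resolve_right (by simpa only [hNx, hNy] using hs)
    refine ⟨hT, fun j ↦ ?_⟩
    simpa only [hNx, hNy] using N.finrank_reflect hT j
  obtain ⟨hMT, hMd⟩ := key hM hMx hMy
  refine ⟨fun j ↦ Module.finrank k (M.reflect.X j), hMd, M.reflect, hM.reflect hMT, fun _ ↦ rfl,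
    hMx, ?_⟩
  rcases h with h | ⟨N, hN, hNx, hNy, h⟩
  · refine .inl fun h' ↦ h ?_
    rw [← h', bipartiteForm.swap (fun i j ↦ Fintype.card (α i j)), ← bipartiteForm.reflect]
    congr 1
    funext j
    have := hMd j
    zify at this
    linarith
  · obtain ⟨hNT, hNd⟩ := key hN hNx hNy
    exact .inr
        ⟨N.reflect, hN.reflect hNT, fun j ↦ Nat.add_right_cancel ((hNd j).trans (hMd j).symm), hNx,
      fun h' ↦ h (h'.of_reflect hMT hNT)⟩

theorem not_isExceptionalDim (hb : IsWeaklyPositive fun i j ↦ Fintype.card (α i j))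
    (x : I → ℕ) (y : J → ℕ) : ¬ IsExceptionalDim k α x y := by
  intro h
  have step (d : {d : (I → ℕ) × (J → ℕ) // IsExceptionalDim k α d.1 d.2}) :
      ∃ d' : {d : (I → ℕ) × (J → ℕ) // IsExceptionalDim k α d.1 d.2},
        (∀ j, d'.1.2 j + d.1.2 j = ∑ i, Fintype.card (α i j) * d.1.1 i) ∧
        ∀ i, d'.1.1 i + d.1.1 i = ∑ j, Fintype.card (α i j) * d'.1.2 j := by
    obtain ⟨⟨x, y⟩, h⟩ := d
    obtain ⟨y', hy', h'⟩ := h.exists_reflect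
    obtain ⟨x', hx', h''⟩ := h'.exists_reflect
    exact ⟨⟨⟨x', y'⟩, h''⟩, hy', hx'⟩
  choose s hs using step
  let d (n : ℕ) := s^[n] ⟨(x, y), h⟩
  have hd (n) : d (n + 1) = s (d n) := Function.iterate_succ_apply' _ _ _
  refine bipartiteForm.false_of_reflections hb (fun n ↦ (d n).1.1) (fun n ↦ (d n).1.2)
    (fun n ↦ ?_) (fun n ↦ ?_) (fun n ↦ ?_)
  · obtain ⟨M, hM, hx, hy, -⟩ := (d n).2
    simpa only [hx, hy] using hM.dim_ne_zero
  · rw [hd]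
    exact (hs _).1
  · rw [hd]
    exact (hs _).2

/-- If the Tits form is weakly positive, an indecomposable representation is determined by its
dimension vector. -/
theorem Indecomposable.iso_of_finrank_eq (hb : IsWeaklyPositive fun i j ↦ Fintype.card (α i j))
    {M N : BipartiteRep k α} (hM : M.Indecomposable) (hN : N.Indecomposable)
    (hX : ∀ i, Module.finrank k (M.X i) = Module.finrank k (N.X i))
    (hY : ∀ j, Module.finrank k (M.Y j) = Module.finrank k (N.Y j)) : Iso M N := by
  by_contra h
  exact not_isExceptionalDim hb _ _
    ⟨M, hM, fun _ ↦ rfl, fun _ ↦ rfl, .inr ⟨N, hN, fun i ↦ (hX i).symm, fun j ↦ (hY j).symm, h⟩⟩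

/-- If the Tits form is weakly positive, there are only finitely many dimension vectors of
indecomposable representations. -/
theorem finite_finrank_indecomposable (hb : IsWeaklyPositive fun i j ↦ Fintype.card (α i j)) :
    {d : (I → ℕ) × (J → ℕ) | ∃ M : BipartiteRep k α, M.Indecomposable ∧
      (fun i ↦ Module.finrank k (M.X i), fun j ↦ Module.finrank k (M.Y j)) = d}.Finite := by
  refine (bipartiteForm.finite_setOf_eq hb 1).subset ?_
  rintro _ ⟨M, hM, rfl⟩
  by_contra h
  exact not_isExceptionalDim hb _ _ ⟨M, hM, fun _ ↦ rfl, fun _ ↦ rfl, .inl h⟩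

end DimensionVectors

end BipartiteRep

/-- Primitive idempotents of an algebra with a square-zero ideal `J` and split semisimple quotient,
one for each simple module, together with a witness that they generate the unit ideal. -/
structure BasicIdempotents (k A : Type) [Field k] [Ring A] [Algebra k A] (ι : Type) where
  /-- The square-zero ideal. -/
  J : Submodule k A
  mul_mem_left : ∀ a, ∀ x ∈ J, a * x ∈ J
  mul_mem_right : ∀ a, ∀ x ∈ J, x * a ∈ J
  mul_eq_zero : ∀ x ∈ J, ∀ y ∈ J, x * y = 0
  /-- The idempotents. -/
  e : ι → A
  e_mul_e : ∀ i, e i * e i = e i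
  exists_corner : ∀ a i, ∃ c : k, e i * a * e i - c • e i ∈ J
  mul_mem_of_ne : ∀ a i j, i ≠ j → e j * a * e i ∈ J
  /-- The index set of a decomposition of the unit. -/
  S : Type
  [fintypeS : Fintype S]
  /-- The idempotent used by a summand of the decomposition of the unit. -/
  idx : S → ι
  /-- The left factors of the decomposition of the unit. -/
  u : S → A
  /-- The right factors of the decomposition of the unit. -/
  v : S → A
  sum_eq_one : ∑ s, u s * (e (idx s) * v s) = 1

attribute [instance] BasicIdempotents.fintypeS

namespace BasicIdempotents

variable {k A ι : Type} [Field k] [Ring A] [Algebra k A] (D : BasicIdempotents k A ι)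

/-- The space `e_j J e_i` of arrows from `i` to `j`. -/
def arrows (i j : ι) : Submodule k A where
  carrier := {m | m ∈ D.J ∧ D.e j * m = m ∧ m * D.e i = m}
  add_mem' hx hy := ⟨add_mem hx.1 hy.1, by rw [mul_add, hx.2.1, hy.2.1],
    by rw [add_mul, hx.2.2, hy.2.2]⟩
  zero_mem' := ⟨zero_mem _, mul_zero _, zero_mul _⟩
  smul_mem' c x hx := ⟨D.J.smul_mem c hx.1, by rw [mul_smul_comm, hx.2.1],
    by rw [smul_mul_assoc, hx.2.2]⟩

theorem mul_mem_arrows {i j : ι} {a : A} (h : D.e j * a * D.e i ∈ D.J) :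
    D.e j * a * D.e i ∈ D.arrows i j :=
  ⟨h, by simp only [← mul_assoc, D.e_mul_e], by rw [mul_assoc, D.e_mul_e]⟩

theorem exists_corner_arrows (a : A) (i : ι) :
    ∃ c : k, D.e i * a * D.e i - c • D.e i ∈ D.arrows i i := by
  obtain ⟨c, hc⟩ := D.exists_corner a i
  have : D.e i * a * D.e i - c • D.e i = D.e i * (a - c • 1) * D.e i := by
    rw [mul_sub, sub_mul, mul_smul_comm, mul_one, smul_mul_assoc, D.e_mul_e]
  refine ⟨c, ?_⟩
  rw [this] at hc ⊢
  exact D.mul_mem_arrows hc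

section Module

variable {N : Type} [AddCommGroup N] [Module A N]

theorem sum_smul (n : N) : ∑ s, D.u s • (D.e (D.idx s) * D.v s) • n = n := by
  simp only [← mul_smul]
  rw [← Finset.sum_smul, D.sum_eq_one, one_smul]

theorem eq_of_forall_smul_eq {n n' : N} (h : ∀ i a, (D.e i * a) • n = (D.e i * a) • n') :
    n = n' := by
  rw [← D.sum_smul n, ← D.sum_smul n']
  simp only [h]

variable [Module k N] [IsScalarTower k A N]

variable (N) in
/-- The space `e_i N`. -/
def part (i : ι) : Submodule k N where
  carrier := {n | D.e i • n = n}
  add_mem' {x y} hx hy := by rw [Set.mem_ofPred_eq] at *; rw [smul_add, hx, hy]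
  zero_mem' := smul_zero _
  smul_mem' c x hx := by
    rw [Set.mem_ofPred_eq] at *
    rw [← algebraMap_smul A c x, ← mul_smul, ← Algebra.commutes, mul_smul, hx]

theorem mul_smul_mem_part (i : ι) (a : A) (n : N) : (D.e i * a) • n ∈ D.part N i := by
  change D.e i • _ = _
  rw [← mul_smul, ← mul_assoc, D.e_mul_e]

theorem arrow_smul_mem_part {i j : ι} {m : A} (hm : m ∈ D.arrows i j) (n : N) :
    m • n ∈ D.part N j := by
  rw [← hm.2.1]
  exact D.mul_smul_mem_part j m n

theorem e_smul {i : ι} (n : D.part N i) : D.e i • (n : N) = n := n.2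

theorem smul_mem_of_stable (W : ∀ i, Submodule k (D.part N i))
    (hW : ∀ i j, ∀ m, ∀ hm : m ∈ D.arrows i j, ∀ w ∈ W i,
      (⟨m • (w : N), D.arrow_smul_mem_part hm _⟩ : D.part N j) ∈ W j)
    (i j : ι) (b : A) (w : D.part N i) (hw : w ∈ W i) :
    (⟨(D.e j * b) • (w : N), D.mul_smul_mem_part j b _⟩ : D.part N j) ∈ W j := by
  have hb : (D.e j * b) • (w : N) = (D.e j * b * D.e i) • (w : N) := by
    rw [mul_smul _ (D.e i), D.e_smul]
  by_cases hij : i = j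
  · subst hij
    obtain ⟨c, hc⟩ := D.exists_corner_arrows b i
    have h1 := hW i i _ hc w hw
    have h2 := add_mem h1 ((W i).smul_mem c hw)
    convert h2 using 1
    apply Subtype.ext
    change (D.e i * b) • (w : N) = (D.e i * b * D.e i - c • D.e i) • (w : N) + c • (w : N)
    rw [hb, sub_smul, smul_assoc, D.e_smul, sub_add_cancel]
  · have hm := D.mul_mem_arrows (D.mul_mem_of_ne b i j hij)
    convert hW i j _ hm w hw using 1
    exact Subtype.ext hb

/-- A linear map between two modules glued from linear maps between their parts. -/
theorem exists_linearMap {N' : Type} [AddCommGroup N'] [Module A N'] [Module k N']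
    [IsScalarTower k A N'] (H : ∀ i, D.part N i →ₗ[k] D.part N' i)
    (hH : ∀ i j, ∀ m, ∀ hm : m ∈ D.arrows i j, ∀ w : D.part N i,
      (H j ⟨m • (w : N), D.arrow_smul_mem_part hm _⟩ : N') = m • (H i w : N')) :
    ∃ ψ : N →ₗ[A] N', ∀ i (w : D.part N i), ψ w = H i w := by
  have hH' (i j) (b : A) (w : D.part N i) :
      (H j ⟨(D.e j * b) • (w : N), D.mul_smul_mem_part j b _⟩ : N') = (D.e j * b) •
          (H i w : N') := by
    have hb (N) [AddCommGroup N] [Module A N] [Module k N] [IsScalarTower k A N]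
        (w : D.part N i) : (D.e j * b) • (w : N) = (D.e j * b * D.e i) • (w : N) := by
      rw [mul_smul _ (D.e i), D.e_smul]
    by_cases hij : i = j
    · subst hij
      obtain ⟨c, hc⟩ := D.exists_corner_arrows b i
      have h1 := hH i i _ hc w
      have h2 (N) [AddCommGroup N] [Module A N] [Module k N] [IsScalarTower k A N]
          (w : D.part N i) : (D.e i * b) • (w : N) =
            (D.e i * b * D.e i - c • D.e i) • (w : N) + c • (w : N) := by
        rw [hb, sub_smul, smul_assoc, D.e_smul, sub_add_cancel]
      rw [h2 N', ← h1, ← Submodule.coe_smul, ← map_smul, ← Submodule.coe_add, ← map_add]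
      congr 2
      exact Subtype.ext (h2 N w)
    · have hm := D.mul_mem_arrows (D.mul_mem_of_ne b i j hij)
      rw [hb N', ← hH i j _ hm]
      congr 2
      exact Subtype.ext (hb N w)
  let P (j : ι) (b : A) (n : N) : D.part N j := ⟨(D.e j * b) • n, D.mul_smul_mem_part j b _⟩
  let ψ (n : N) : N' := ∑ s, D.u s • (H (D.idx s) (P (D.idx s) (D.v s) n) : N')
  have hψ (j) (b : A) (n : N) : (D.e j * b) • ψ n = H j (P j b n) := by
    have : P j b n = ∑ s, P j (b * D.u s) (P (D.idx s) (D.v s) n) := by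
      apply Subtype.ext
      rw [Submodule.coe_sum]
      change (D.e j * b) • n = ∑ s, (D.e j * (b * D.u s)) • (D.e (D.idx s) * D.v s) • n
      nth_rw 1 [← D.sum_smul n]
      simp only [Finset.smul_sum, ← mul_smul, mul_assoc]
    rw [this, map_sum, Submodule.coe_sum, Finset.smul_sum]
    refine Finset.sum_congr rfl fun s _ ↦ ?_
    rw [hH', ← mul_smul, mul_assoc]
  refine ⟨{ toFun := ψ, map_add' := fun x y ↦ ?_, map_smul' := fun a x ↦ ?_ }, fun i w ↦ ?_⟩
  · refine D.eq_of_forall_smul_eq fun j b ↦ ?_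
    rw [smul_add, hψ, hψ, hψ, ← Submodule.coe_add, ← map_add]
    congr 2
    exact Subtype.ext (smul_add _ _ _)
  · refine D.eq_of_forall_smul_eq fun j b ↦ ?_
    rw [RingHom.id_apply, ← mul_smul, mul_assoc, hψ, hψ]
    congr 2
    apply Subtype.ext
    change (D.e j * b) • a • x = (D.e j * (b * a)) • x
    rw [← mul_smul, mul_assoc]
  · refine D.eq_of_forall_smul_eq fun j b ↦ ?_
    exact (hψ _ _ _).trans (hH' i j b w)

theorem linearMap_ext {N' : Type} [AddCommGroup N'] [Module A N'] {f g : N →ₗ[A] N'}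
    (h : ∀ i (w : D.part N i), f w = g w) : f = g := by
  ext n
  rw [← D.sum_smul n]
  rw [map_sum, map_sum]
  refine Finset.sum_congr rfl fun s _ ↦ ?_
  rw [map_smul f, map_smul g, h _ ⟨_, D.mul_smul_mem_part (D.idx s) (D.v s) n⟩]

/-- A linear equivalence between two modules glued from linear equivalences of their parts. -/
theorem nonempty_linearEquiv {N' : Type} [AddCommGroup N'] [Module A N'] [Module k N']
    [IsScalarTower k A N'] (H : ∀ i, D.part N i ≃ₗ[k] D.part N' i)
    (hH : ∀ i j, ∀ m, ∀ hm : m ∈ D.arrows i j, ∀ w : D.part N i,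
      (H j ⟨m • (w : N), D.arrow_smul_mem_part hm _⟩ : N') = m • (H i w : N')) :
    Nonempty (N ≃ₗ[A] N') := by
  obtain ⟨f, hf⟩ := D.exists_linearMap (fun i ↦ (H i).toLinearMap) hH
  obtain ⟨g, hg⟩ := D.exists_linearMap (fun i ↦ (H i).symm.toLinearMap) (fun i j m hm w ↦ by
    have := hH i j m hm ((H i).symm w)
    rw [LinearEquiv.apply_symm_apply] at this
    simp only [LinearEquiv.coe_coe]
    rw [← Subtype.coe_mk (m • ((H i).symm w : N)) (D.arrow_smul_mem_part hm _)]
    congr 1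
    rw [LinearEquiv.symm_apply_eq]
    exact Subtype.ext this.symm)
  refine ⟨LinearEquiv.ofLinearMap f g (D.linearMap_ext fun i w ↦ ?_) (D.linearMap_ext fun i w ↦ ?_)⟩
  · rw [LinearMap.comp_apply, hg, hf]
    simp
  · rw [LinearMap.comp_apply, hf, hg]
    simp

end Module

end BasicIdempotents

theorem Submodule.isCompl_prod {k V W : Type} [Ring k] [AddCommGroup V] [AddCommGroup W]
    [Module k V] [Module k W] {X₁ X₂ : Submodule k V} {Y₁ Y₂ : Submodule k W}
    (hX : IsCompl X₁ X₂) (hY : IsCompl Y₁ Y₂) : IsCompl (X₁.prod Y₁) (X₂.prod Y₂) := by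
  constructor
  · rw [disjoint_iff, Submodule.prod_inf_prod, hX.inf_eq_bot, hY.inf_eq_bot, Submodule.prod_bot]
  · rw [codisjoint_iff, Submodule.prod_sup_prod, hX.sup_eq_top, hY.sup_eq_top, Submodule.prod_top]

namespace BasicIdempotents

variable {k A ι : Type} [Field k] [Ring A] [Algebra k A] (D : BasicIdempotents k A ι)

variable (N : Type) [AddCommGroup N] [Module A N] [Module k N] [IsScalarTower k A N]

/-- The part of `e_i N` annihilated by `J`. -/
def socle (i : ι) : Submodule k (D.part N i) where
  carrier := {n | ∀ x ∈ D.J, x • (n : N) = 0}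
  add_mem' {a b} ha hb x hx := by rw [Submodule.coe_add, smul_add, ha x hx, hb x hx, add_zero]
  zero_mem' x _ := smul_zero x
  smul_mem' c n hn x hx := by rw [Submodule.coe_smul, smul_comm, hn x hx, smul_zero]

/-- A vector space complement of the socle in `e_i N`. -/
noncomputable def head (i : ι) : Submodule k (D.part N i) :=
  (exists_isCompl (D.socle N i)).choose

theorem isCompl_head_socle (i : ι) : IsCompl (D.head N i) (D.socle N i) :=
  (exists_isCompl (D.socle N i)).choose_spec.symm

/-- The action of the arrows on the parts of a module. -/
def arrowMap (i j : ι) : D.arrows i j →ₗ[k] D.part N i →ₗ[k] D.socle N j :=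
  LinearMap.mk₂ k (fun m n ↦ ⟨⟨(m : A) • (n : N), D.arrow_smul_mem_part m.2 _⟩, fun x hx ↦ by
      change x • (m : A) • (n : N) = 0
      rw [← mul_smul, D.mul_eq_zero x hx _ m.2.1, zero_smul]⟩)
    (fun _ _ _ ↦ Subtype.ext (Subtype.ext (add_smul _ _ _)))
    (fun _ _ _ ↦ Subtype.ext (Subtype.ext (smul_assoc _ _ _)))
    (fun _ _ _ ↦ Subtype.ext (Subtype.ext (smul_add _ _ _)))
    (fun _ _ _ ↦ Subtype.ext (Subtype.ext (smul_comm _ _ _)))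

theorem coe_arrowMap {i j : ι} (m : D.arrows i j) (n : D.part N i) :
    ((D.arrowMap N i j m n : D.part N j) : N) = (m : A) • (n : N) := rfl

theorem arrowMap_socle {i j : ι} (m : D.arrows i j) {n : D.part N i} (hn : n ∈ D.socle N i) :
    D.arrowMap N i j m n = 0 :=
  Subtype.ext (Subtype.ext (hn m m.2.1))

variable [FiniteDimensional k A]

theorem arrowMap_eq_sum {i j : ι} (m : D.arrows i j) (n : D.part N i) :
    D.arrowMap N i j m n = ∑ a, (Module.finBasis k (D.arrows i j)).repr m a •
      D.arrowMap N i j (Module.finBasis k (D.arrows i j) a) n := by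
  conv_lhs => rw [← (Module.finBasis k (D.arrows i j)).sum_repr m]
  rw [map_sum, LinearMap.sum_apply]
  simp only [map_smul, LinearMap.smul_apply]

variable [FiniteDimensional k N]

/-- The representation of the separated quiver attached to a module. -/
noncomputable def rep : BipartiteRep k fun i j ↦ Fin (Module.finrank k (D.arrows i j)) where
  X i := D.head N i
  Y j := D.socle N j
  φ i j a := D.arrowMap N i j (Module.finBasis k (D.arrows i j) a) ∘ₗ (D.head N i).subtype

variable {N}

theorem nonempty_linearEquiv_of_iso {N' : Type} [AddCommGroup N'] [Module A N'] [Module k N']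
    [IsScalarTower k A N'] [FiniteDimensional k N'] (h : (D.rep N).Iso (D.rep N')) :
    Nonempty (N ≃ₗ[A] N') := by
  obtain ⟨F, G, hFG⟩ := h
  let F' (i) : D.head N i ≃ₗ[k] D.head N' i := F i
  let G' (i) : D.socle N i ≃ₗ[k] D.socle N' i := G i
  let H (i) : D.part N i ≃ₗ[k] D.part N' i :=
    (Submodule.prodEquivOfIsCompl _ _ (D.isCompl_head_socle N i)).symm ≪≫ₗ
      (F' i).prodCongr (G' i) ≪≫ₗ Submodule.prodEquivOfIsCompl _ _ (D.isCompl_head_socle N' i)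
  have hH (i) (x : D.head N i) (y : D.socle N i) : H i (x + y) = F' i x + G' i y := by
    have : (Submodule.prodEquivOfIsCompl _ _ (D.isCompl_head_socle N i)).symm (x + y) = (x, y) := by
      rw [LinearEquiv.symm_apply_eq]; simp
    simp [H, LinearEquiv.trans_apply, this]
  have hHs (i) (y : D.socle N i) : H i y = G' i y := by
    have := hH i 0 y
    rwa [Submodule.coe_zero, zero_add, map_zero, Submodule.coe_zero, zero_add] at this
  refine D.nonempty_linearEquiv H fun i j m hm w ↦ ?_
  obtain ⟨⟨x, y⟩, rfl⟩ := (Submodule.prodEquivOfIsCompl _ _ (D.isCompl_head_socle N i)).surjective w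
  rw [Submodule.coe_prodEquivOfIsCompl']
  change (H j (D.arrowMap N i j ⟨m, hm⟩ (x + y)) : N') =
    ((D.arrowMap N' i j ⟨m, hm⟩ (H i (x + y)) : D.part N' j) : N')
  rw [hH, hHs, map_add (D.arrowMap N i j _), map_add (D.arrowMap N' i j _),
    D.arrowMap_socle _ _ y.2, D.arrowMap_socle _ _ (G' i y).2,
    add_zero, add_zero, arrowMap_eq_sum, arrowMap_eq_sum, map_sum]
  simp only [map_smul]
  congr 3
  funext a
  congr 1
  exact hFG i j a x

theorem indecomposable_rep (hN : IsIndecomposableModule A N) : (D.rep N).Indecomposable where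
  nonzero := by
    rintro ⟨hX, hY⟩
    obtain ⟨v, hv⟩ := hN.1
    apply hv
    have (i : ι) (w : D.part N i) : w = 0 := by
      have : Subsingleton (D.head N i) := hX i
      have : Subsingleton (D.socle N i) := hY i
      exact @Subsingleton.elim _ (Submodule.prodEquivOfIsCompl _ _
        (D.isCompl_head_socle N i)).symm.injective.subsingleton _ _
    refine D.eq_of_forall_smul_eq (k := k) fun i a ↦ ?_
    rw [smul_zero]
    exact congrArg Subtype.val (this i ⟨_, D.mul_smul_mem_part i a v⟩)
  eq_bot X₁ X₂ Y₁ Y₂ hX hY h₁ h₂ := by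
    let E (i) := Submodule.prodEquivOfIsCompl _ _ (D.isCompl_head_socle N i)
    let W (X : ∀ i, Submodule k (D.head N i)) (Y : ∀ i, Submodule k (D.socle N i)) (i) :
        Submodule k (D.part N i) := ((X i).prod (Y i)).map (E i : _ →ₗ[k] _)
    have hW (i) : IsCompl (W X₁ Y₁ i) (W X₂ Y₂ i) :=
      (Submodule.orderIsoMapComap (E i)).isCompl (Submodule.isCompl_prod (hX i) (hY i))
    have stable (X : ∀ i, Submodule k (D.head N i)) (Y : ∀ i, Submodule k (D.socle N i))
        (h : ∀ i j a, ∀ x ∈ X i, (D.rep N).φ i j a x ∈ Y j) :=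
      D.smul_mem_of_stable (W X Y) fun i j m hm w hw ↦ by
        obtain ⟨⟨x, y⟩, ⟨hx, -⟩, rfl⟩ := hw
        refine ⟨(0, D.arrowMap N i j ⟨m, hm⟩ (x + y)), ⟨zero_mem _, ?_⟩, ?_⟩
        · rw [map_add, D.arrowMap_socle _ _ y.2, add_zero, arrowMap_eq_sum]
          rw [SetLike.mem_coe]
          dsimp only
          refine Submodule.sum_mem (Y j) fun a _ ↦ (Y j).smul_mem _ ?_
          exact h i j a x hx
        · apply Subtype.ext
          simp only [E, LinearEquiv.coe_coe, Submodule.coe_prodEquivOfIsCompl', coe_arrowMap,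
            Submodule.coe_zero, zero_add]
    let S (X : ∀ i, Submodule k (D.head N i)) (Y : ∀ i, Submodule k (D.socle N i)) :
        Submodule A N :=
      { carrier := {n | ∀ i a,
          (⟨(D.e i * a) • n, D.mul_smul_mem_part i a n⟩ : D.part N i) ∈ W X Y i}
        add_mem' := fun {x y} hx hy i a ↦ by
          convert add_mem (hx i a) (hy i a) using 1
          exact Subtype.ext (smul_add _ _ _)
        zero_mem' := fun i a ↦ by
          convert zero_mem (W X Y i) using 1
          exact Subtype.ext (smul_zero _)
        smul_mem' := fun b n hn i a ↦ by
          convert hn i (a * b) using 1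
          apply Subtype.ext
          change (D.e i * a) • b • n = (D.e i * (a * b)) • n
          rw [← mul_smul, mul_assoc] }
    have hS (X : ∀ i, Submodule k (D.head N i)) (Y : ∀ i, Submodule k (D.socle N i))
        (h : ∀ i j a, ∀ x ∈ X i, (D.rep N).φ i j a x ∈ Y j) (i : ι) (w : D.part N i)
            (hw : w ∈ W X Y i) : (w : N) ∈ S X Y :=
      fun j a ↦ stable X Y h i j a w hw
    have hbot (X : ∀ i, Submodule k (D.head N i)) (Y : ∀ i, Submodule k (D.socle N i))
        (h : ∀ i j a, ∀ x ∈ X i, (D.rep N).φ i j a x ∈ Y j) (h0 : S X Y = ⊥) :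
            (∀ i, X i = ⊥) ∧ ∀ i, Y i = ⊥ := by
      have h0' (i : ι) (x : X i) (y : Y i) : E i (x, y) = 0 := by
        have := hS X Y h i (E i (x, y)) ⟨(x, y), ⟨x.2, y.2⟩, rfl⟩
        rw [h0, Submodule.mem_bot] at this
        exact Subtype.ext this
      constructor
      · intro i
        rw [Submodule.eq_bot_iff]
        intro x hx
        have := h0' i ⟨x, hx⟩ 0
        rw [LinearEquiv.map_eq_zero_iff] at this
        exact congrArg Prod.fst this
      · intro i
        rw [Submodule.eq_bot_iff]
        intro y hy
        have := h0' i 0 ⟨y, hy⟩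
        rw [LinearEquiv.map_eq_zero_iff] at this
        exact congrArg Prod.snd this
    refine (hN.2 (S X₁ Y₁) (S X₂ Y₂) ⟨?_, ?_⟩).imp (hbot _ _ h₁) (hbot _ _ h₂)
    · rw [Submodule.disjoint_def]
      intro n hn₁ hn₂
      refine D.eq_of_forall_smul_eq (k := k) fun i a ↦ ?_
      rw [smul_zero]
      exact congrArg Subtype.val (Submodule.disjoint_def.1 (hW i).disjoint _ (hn₁ i a) (hn₂ i a))
    · rw [codisjoint_iff, eq_top_iff]
      rintro n -
      rw [← D.sum_smul n]
      refine sum_mem fun s _ ↦ Submodule.smul_mem _ _ ?_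
      obtain ⟨w₁, hw₁, w₂, hw₂, hw⟩ := Submodule.mem_sup.1 ((hW (D.idx s)).sup_eq_top.ge
        (Submodule.mem_top (x := ⟨_, D.mul_smul_mem_part (D.idx s) (D.v s) n⟩)))
      have hw' : (w₁ : N) + w₂ = (D.e (D.idx s) * D.v s) • n := congrArg Subtype.val hw
      rw [← hw']
      exact Submodule.add_mem_sup (hS _ _ h₁ _ _ hw₁) (hS _ _ h₂ _ _ hw₂)

theorem finiteRepresentationType [Fintype ι]
    (hb : IsWeaklyPositive fun i j ↦ Module.finrank k (D.arrows i j)) :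
    FiniteRepresentationType A := by
  have hb' : IsWeaklyPositive fun i j ↦ Fintype.card (Fin (Module.finrank k (D.arrows i j))) := by
    simpa only [Fintype.card_fin] using hb
  let modk (N : ModuleCat.{0} A) : Module k N := Module.compHom N (algebraMap k A)
  have tower (N : ModuleCat.{0} A) : IsScalarTower k A N :=
    ⟨fun c a n ↦ by rw [Algebra.smul_def, mul_smul]; rfl⟩
  have fin (N : ModuleCat.{0} A) (hN : Module.Finite A N) : FiniteDimensional k N :=
    Module.Finite.trans A N
  let dims (N : ModuleCat.{0} A) (hN : Module.Finite A N) : (ι → ℕ) × (ι → ℕ) :=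
    have := fin N hN
    (fun i ↦ Module.finrank k ((D.rep N).X i), fun j ↦ Module.finrank k ((D.rep N).Y j))
  let T := {d // ∃ (N : ModuleCat.{0} A) (hN : Module.Finite A N),
    IsIndecomposableModule A N ∧ dims N hN = d}
  have hT : Finite T := by
    refine ((BipartiteRep.finite_finrank_indecomposable (k := k) hb').subset ?_).to_subtype
    rintro _ ⟨N, hN, hN', rfl⟩
    have := fin N hN
    exact ⟨D.rep N, D.indecomposable_rep hN', rfl⟩
  refine ⟨T, hT, fun d ↦ d.2.choose, fun N hN hN' ↦ ?_⟩
  let d : T := ⟨dims N hN, N, hN, hN', rfl⟩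
  refine ⟨d, ?_⟩
  obtain ⟨hM, hM', hdim⟩ := d.2.choose_spec
  have := fin N hN
  have := fin _ hM
  have hd := Prod.ext_iff.1 hdim
  exact D.nonempty_linearEquiv_of_iso ((D.indecomposable_rep hN').iso_of_finrank_eq hb'
    (D.indecomposable_rep hM') (fun i ↦ (congrFun hd.1 i).symm) (fun i ↦ (congrFun hd.2 i).symm))

end BasicIdempotents

theorem FiniteRepresentationType.exists_of_length_le {A : Type} [Ring A] [IsArtinianRing A]
    (h : FiniteRepresentationType A) (n : ℕ) :
    ∃ (ι : Type) (_ : Finite ι) (M : ι → ModuleCat.{0} A),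
      ∀ (N : ModuleCat.{0} A), Module.Finite A N → Module.length A N ≤ n →
        ∃ i, Nonempty (N ≃ₗ[A] M i) := by
  obtain ⟨ι, _, M, hM⟩ := h
  induction n with
  | zero =>
    refine ⟨Unit, inferInstance, fun _ ↦ ModuleCat.of A PUnit, fun N _ hN ↦ ⟨(), ?_⟩⟩
    have : Subsingleton N := Module.length_eq_zero_iff.1 (le_antisymm (by simpa using hN) bot_le)
    exact ⟨{ toFun := fun _ ↦ 0, invFun := fun _ ↦ 0, map_add' := by simp, map_smul' := by simp,
             left_inv := fun _ ↦ Subsingleton.elim _ _, right_inv := fun _ ↦ rfl }⟩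
  | succ n ih =>
    obtain ⟨κ, _, P, hP⟩ := ih
    refine ⟨κ ⊕ (ι ⊕ κ × κ), inferInstance,
      Sum.elim P (Sum.elim M fun p ↦ ModuleCat.of A (P p.1 × P p.2)), fun N hN hlen ↦ ?_⟩
    by_cases hz : Module.length A N ≤ n
    · obtain ⟨i, hi⟩ := hP N hN hz
      exact ⟨Sum.inl i, hi⟩
    by_cases hind : IsIndecomposableModule A N
    · obtain ⟨i, hi⟩ := hM N hN hind
      exact ⟨Sum.inr (Sum.inl i), hi⟩
    have hne : ∃ v : N, v ≠ 0 := by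
      by_contra! hv
      apply hz
      have : Subsingleton N := ⟨fun a b ↦ (hv a).trans (hv b).symm⟩
      rw [Module.length_eq_zero]
      exact bot_le
    simp only [IsIndecomposableModule, hne, true_and, not_forall, not_or] at hind
    obtain ⟨N₁, N₂, hc, h₁, h₂⟩ := hind
    let E := Submodule.prodEquivOfIsCompl N₁ N₂ hc
    have hsum : Module.length A N₁ + Module.length A N₂ ≤ n + 1 := by
      rw [← Module.length_prod, E.length_eq]
      exact_mod_cast hlen
    have pos (N' : Submodule A N) (h : N' ≠ ⊥) : 1 ≤ Module.length A N' := by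
      have := Submodule.nontrivial_iff_ne_bot.2 h
      exact Order.one_le_iff_pos.2 Module.length_pos
    have key (a b : ℕ∞) (hb : 1 ≤ b) (h : a + b ≤ n + 1) : a ≤ n := by
      have : a + 1 ≤ n + 1 := (add_le_add_right hb a).trans h
      exact (ENat.add_le_add_iff_right ENat.one_ne_top).1 this
    obtain ⟨i₁, ⟨g₁⟩⟩ := hP (ModuleCat.of A N₁) inferInstance (key _ _ (pos N₂ h₂) hsum)
    obtain ⟨i₂, ⟨g₂⟩⟩ := hP (ModuleCat.of A N₂) inferInstance
      (key _ _ (pos N₁ h₁) (by rwa [add_comm]))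
    exact ⟨Sum.inr (Sum.inr (i₁, i₂)), ⟨E.symm ≪≫ₗ g₁.prodCongr g₂⟩⟩

theorem hasFinitelyManyConjClassesOfLeftIdeals_of_quotient {A : Type} [Ring A] [IsArtinianRing A]
    (hA : ∀ L L' : Submodule A A, Nonempty ((A ⧸ L) ≃ₗ[A] (A ⧸ L')) → ConjLeftIdeal A L L')
    (h : FiniteRepresentationType A) : HasFinitelyManyConjClassesOfLeftIdeals A := by
  obtain ⟨n, hn⟩ := ENat.ne_top_iff_exists.1 (Module.length_ne_top (R := A) (M := A))
  obtain ⟨ι, _, M, hM⟩ := h.exists_of_length_le n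
  have (L : Submodule A A) : ∃ i, Nonempty ((A ⧸ L) ≃ₗ[A] M i) :=
    hM (ModuleCat.of A (A ⧸ L)) inferInstance
      ((Module.length_le_of_surjective L.mkQ L.mkQ_surjective).trans hn.ge)
  choose f hf using this
  refine Finite.of_injective (fun q : Quot (ConjLeftIdeal A) ↦ f q.out) fun q q' hq ↦ ?_
  rw [← Quot.out_eq q, ← Quot.out_eq q']
  obtain ⟨g⟩ := hf q.out
  obtain ⟨g'⟩ := hf q'.out
  dsimp only at hq
  rw [hq] at g
  exact Quot.sound (hA _ _ ⟨g ≪≫ₗ g'.symm⟩)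

/-- Bass's stable range one condition. -/
def StableRangeOne (R : Type) [Ring R] : Prop :=
  ∀ a b l : R, b * a + l = 1 → ∃ c, IsUnit (a + c * l)

namespace StableRangeOne

theorem of_ringEquiv {R S : Type} [Ring R] [Ring S] (E : R ≃+* S) (h : StableRangeOne R) :
    StableRangeOne S := fun a b l hl ↦ by
  obtain ⟨c, hc⟩ := h (E.symm a) (E.symm b) (E.symm l) (by
    rw [← map_mul, ← map_add, hl, map_one])
  refine ⟨E c, ?_⟩
  simpa using hc.map E

theorem pi {ι : Type} {R : ι → Type} [∀ i, Ring (R i)] (h : ∀ i, StableRangeOne (R i)) :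
    StableRangeOne (∀ i, R i) := fun a b l hl ↦ by
  choose c hc using fun i ↦ h i (a i) (b i) (l i) (congrFun hl i)
  exact ⟨c, Pi.isUnit_iff.2 hc⟩

theorem moduleEnd (k V : Type) [Field k] [AddCommGroup V] [Module k V] [FiniteDimensional k V] :
    StableRangeOne (Module.End k V) := fun a b l hl ↦ by
  obtain ⟨C, hC⟩ := Submodule.exists_isCompl a.range
  have hdim : Module.finrank k a.ker = Module.finrank k C := by
    have h1 := a.finrank_range_add_finrank_ker
    have h2 := Submodule.finrank_add_eq_of_isCompl hC
    omega
  let E : a.ker ≃ₗ[k] C := LinearEquiv.ofFinrankEq _ _ hdim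
  have hinj : (l ∘ₗ a.ker.subtype).ker = ⊥ := by
    rw [LinearMap.ker_eq_bot']
    rintro ⟨v, hv⟩ hlv
    have := LinearMap.congr_fun hl v
    simp only [LinearMap.comp_apply, Submodule.subtype_apply] at hlv
    rw [LinearMap.mem_ker] at hv
    simp only [LinearMap.add_apply, Module.End.mul_apply, hv, hlv, map_zero, add_zero,
      Module.End.one_apply] at this
    exact Subtype.ext this.symm
  obtain ⟨g, hg⟩ := (l ∘ₗ a.ker.subtype).exists_leftInverse_of_injective hinj
  refine ⟨C.subtype ∘ₗ E ∘ₗ g, ?_⟩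
  rw [LinearMap.isUnit_iff_ker_eq_bot, LinearMap.ker_eq_bot']
  intro v hv
  change a v + (E (g (l v)) : V) = 0 at hv
  have h1 : a v ∈ C := by
    rw [eq_neg_of_add_eq_zero_left hv]
    exact neg_mem (E _).2
  have h2 : a v = 0 := Submodule.disjoint_def.1 hC.disjoint _ ⟨v, rfl⟩ h1
  rw [h2, zero_add, Submodule.coe_eq_zero, LinearEquiv.map_eq_zero_iff] at hv
  have h3 := LinearMap.congr_fun hg ⟨v, h2⟩
  exact congrArg Subtype.val (h3.symm.trans hv)

theorem matrix (k n : Type) [Field k] [Fintype n] [DecidableEq n] :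
    StableRangeOne (Matrix n n k) :=
  (moduleEnd k (n → k)).of_ringEquiv Matrix.toLinAlgEquiv'.symm.toRingEquiv

end StableRangeOne

theorem isUnit_of_mul_self_eq_zero_of_map {R S : Type} [Ring R] [Ring S] (φ : R →+* S)
    (hφ : Function.Surjective φ) (hker : ∀ x, φ x = 0 → x * x = 0) {x : R} (hx : IsUnit (φ x)) :
    IsUnit x := by
  have key (z : R) (hz : φ z = 1) : IsUnit z := by
    have : IsNilpotent (z - 1) :=
        ⟨2, by rw [sq]; exact hker _ (by rw [map_sub, hz, map_one, sub_self])⟩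
    simpa using this.isUnit_add_one
  obtain ⟨y, hy⟩ := hφ ↑(hx.unit⁻¹)
  obtain ⟨p, hp⟩ := key (x * y) (by rw [map_mul, hy]; exact hx.mul_val_inv)
  obtain ⟨q, hq⟩ := key (y * x) (by rw [map_mul, hy]; exact hx.val_inv_mul)
  have h1 : x * (y * ↑p⁻¹) = 1 := by rw [← mul_assoc, ← hp, Units.mul_inv]
  have h2 : (↑q⁻¹ * y) * x = 1 := by rw [mul_assoc, ← hq, Units.inv_mul]
  have h3 := left_inv_eq_right_inv h2 h1
  exact ⟨⟨x, y * ↑p⁻¹, h1, by rw [← h3, h2]⟩, rfl⟩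

theorem StableRangeOne.of_surjective {R S : Type} [Ring R] [Ring S] (φ : R →+* S)
    (hφ : Function.Surjective φ) (hker : ∀ x, φ x = 0 → x * x = 0) (h : StableRangeOne S) :
    StableRangeOne R := fun a b l hl ↦ by
  obtain ⟨c, hc⟩ := h (φ a) (φ b) (φ l) (by rw [← map_mul, ← map_add, hl, map_one])
  obtain ⟨c, rfl⟩ := hφ c
  exact ⟨c, isUnit_of_mul_self_eq_zero_of_map φ hφ hker (by simpa using hc)⟩

theorem StableRangeOne.conjLeftIdeal {A : Type} [Ring A] (hA : StableRangeOne A)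
    {L L' : Submodule A A} (f : (A ⧸ L) ≃ₗ[A] (A ⧸ L')) : ConjLeftIdeal A L L' := by
  obtain ⟨a, ha⟩ := L'.mkQ_surjective (f (L.mkQ 1))
  obtain ⟨b, hb⟩ := L.mkQ_surjective (f.symm (L'.mkQ 1))
  have hf (x : A) : f (L.mkQ x) = L'.mkQ (x * a) := by
    rw [← smul_eq_mul, map_smul, ha, ← map_smul, ← map_smul, smul_eq_mul, mul_one]
  have hl : 1 - b * a ∈ L' := by
    rw [← L'.ker_mkQ, LinearMap.mem_ker, map_sub, ← hf, hb, LinearEquiv.apply_symm_apply, sub_self]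
  obtain ⟨c, u, hu⟩ := hA a b (1 - b * a) (by abel)
  have hmem (x : A) : x ∈ L ↔ x * u ∈ L' := by
    have hx : L'.mkQ (x * u) = f (L.mkQ x) := by
      rw [hf, hu, mul_add, map_add, ← mul_assoc, ← smul_eq_mul (x * c), map_smul]
      rw [show L'.mkQ (1 - b * a) = 0 by rwa [← LinearMap.mem_ker, L'.ker_mkQ], smul_zero, add_zero]
    rw [← L'.ker_mkQ, LinearMap.mem_ker, hx, LinearEquiv.map_eq_zero_iff, ← LinearMap.mem_ker,
      L.ker_mkQ]
  refine ⟨u⁻¹, Set.ext fun y ↦ ⟨fun hy ↦ ⟨u * y * ↑u⁻¹, ?_, ?_⟩, ?_⟩⟩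
  · rw [SetLike.mem_coe, hmem, mul_assoc, Units.inv_mul, mul_one]
    exact L'.smul_mem _ hy
  · simp [mul_assoc]
  · rintro ⟨x, hx, rfl⟩
    rw [inv_inv]
    dsimp only
    rw [mul_assoc]
    exact L'.smul_mem _ ((hmem x).1 hx)

section DualSystem

variable {k A : Type} [Field k] [Ring A] [Algebra k A] {K : Type} [DecidableEq K]
  {r : K → ℕ}

/-- A matrix unit of one factor of a product of matrix algebras. -/
def piMatrixUnit (k : Type) [Field k] {K : Type} [DecidableEq K] {r : K → ℕ} (i : K)
    (s t : Fin (r i)) : ∀ i : K, Matrix (Fin (r i)) (Fin (r i)) k :=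
  Pi.single i (Matrix.single s t 1)

theorem piMatrixUnit_mul_mul (i : K) (s t s' t' : Fin (r i))
    (x : ∀ i : K, Matrix (Fin (r i)) (Fin (r i)) k) :
    piMatrixUnit k i s t * x * piMatrixUnit k i s' t' = x i t s' • piMatrixUnit k i s t' := by
  funext l
  by_cases h : l = i
  · subst h
    simp [piMatrixUnit, Matrix.single_mul_mul_single]
  · simp [piMatrixUnit, h]

theorem piMatrixUnit_mul (i : K) (s t s' t' : Fin (r i)) :
    piMatrixUnit k i s t * piMatrixUnit k i s' t' =
      if t = s' then piMatrixUnit k i s t' else 0 := by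
  have := piMatrixUnit_mul_mul (k := k) i s t s' t' 1
  rw [mul_one, Pi.one_apply, Matrix.one_apply] at this
  rw [this]
  split_ifs <;> simp

theorem piMatrixUnit_mul_mul_of_ne {i j : K} (h : i ≠ j) (s t : Fin (r j)) (s' t' : Fin (r i))
    (x : ∀ i : K, Matrix (Fin (r i)) (Fin (r i)) k) :
    piMatrixUnit k j s t * x * piMatrixUnit k i s' t' = 0 := by
  funext l
  by_cases hl : l = i
  · subst hl
    simp [piMatrixUnit, h]
  · simp [piMatrixUnit, hl]

theorem sum_piMatrixUnit [Fintype K] :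
    ∑ s : Σ i, Fin (r i), piMatrixUnit k s.1 s.2 s.2 = 1 := by
  rw [Fintype.sum_sigma]
  funext i
  rw [Finset.sum_apply, Finset.sum_eq_single i]
  · simpa [piMatrixUnit] using Matrix.sum_single_one (α := k) (m := Fin (r i))
  · intro j _ hj
    simp [piMatrixUnit, hj.symm]
  · simp

theorem BasicIdempotents.exists_dualSystem [Fintype K]
    (φ : A →ₐ[k] (∀ i : K, Matrix (Fin (r i)) (Fin (r i)) k)) (hφ : Function.Surjective φ)
    (hker : ∀ x y, φ x = 0 → φ y = 0 → x * y = 0) (hr : ∀ i, 0 < r i) :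
    ∃ (D : BasicIdempotents k A K) (c a : (Σ i, Fin (r i)) → A),
      (∀ i, D.e i ∉ D.J) ∧ (∀ s, c s * D.e s.1 = c s) ∧ (∀ s, D.e s.1 * a s = a s) ∧
      (∀ s, a s * c s = D.e s.1) ∧ (∀ s t, s ≠ t → a s * c t = 0) := by
  let o (i : K) : Fin (r i) := ⟨0, hr i⟩
  have hnil : ∀ x ∈ RingHom.ker φ.toRingHom, IsNilpotent x := fun x hx ↦ ⟨2, by
    rw [sq]; exact hker x x hx hx⟩
  choose e he hφe using fun i ↦ exists_isIdempotentElem_eq_of_ker_isNilpotent φ.toRingHom hnil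
    (piMatrixUnit k i (o i) (o i)) (hφ _) (by
      rw [IsIdempotentElem, piMatrixUnit_mul, if_pos rfl])
  choose c₀ hc₀ using fun s : Σ i, Fin (r i) ↦ hφ (piMatrixUnit k s.1 s.2 (o s.1))
  choose a₀ ha₀ using fun s : Σ i, Fin (r i) ↦ hφ (piMatrixUnit k s.1 (o s.1) s.2)
  replace hφe (i) : φ (e i) = piMatrixUnit k i (o i) (o i) := hφe i
  replace he (i) : e i * e i = e i := he i
  let c (s : Σ i, Fin (r i)) := c₀ s * e s.1
  let a₁ (s : Σ i, Fin (r i)) := e s.1 * a₀ s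
  have hc (s) : φ (c s) = piMatrixUnit k s.1 s.2 (o s.1) := by
    rw [map_mul, hc₀, hφe, piMatrixUnit_mul, if_pos rfl]
  have ha₁ (s) : φ (a₁ s) = piMatrixUnit k s.1 (o s.1) s.2 := by
    rw [map_mul, ha₀, hφe, piMatrixUnit_mul, if_pos rfl]
  have hce (s) : c s * e s.1 = c s := by rw [mul_assoc, he]
  have hea (s) : e s.1 * a₁ s = a₁ s := by rw [← mul_assoc, he]
  let δ (s t : Σ i, Fin (r i)) : A := if s = t then e s.1 else 0
  let d (s t : Σ i, Fin (r i)) := a₁ s * c t - δ s t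
  have hd (s t) : φ (d s t) = 0 := by
    rw [map_sub, map_mul, ha₁, hc, sub_eq_zero]
    obtain ⟨i, s⟩ := s
    obtain ⟨j, t⟩ := t
    by_cases hij : i = j
    · subst hij
      rw [piMatrixUnit_mul]
      by_cases hst : s = t
      · subst hst; simp [δ, hφe]
      · simp [δ, hst]
    · have := piMatrixUnit_mul_mul_of_ne (k := k) (Ne.symm hij) (o i) s t (o j) 1
      rw [mul_one] at this
      simp [δ, hij, this]
  have hac (s t) : a₁ s * c t = δ s t + d s t := by simp [d]
  have hδe (s t) : δ s t * e t.1 = δ s t := by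
    by_cases h : s = t
    · subst h; simp [δ, he]
    · simp [δ, h]
  have heδ (s t) : e s.1 * δ s t = δ s t := by
    by_cases h : s = t
    · subst h; simp [δ, he]
    · simp [δ, h]
  have hde (s t) : d s t * e t.1 = d s t := by
    simp only [d]; rw [sub_mul, hδe, mul_assoc, hce]
  have hed (s t) : e s.1 * d s t = d s t := by
    simp only [d]; rw [mul_sub, heδ, ← mul_assoc, hea]
  let a (s : Σ i, Fin (r i)) := a₁ s - ∑ t, d s t * a₁ t
  have hea' (s) : e s.1 * a s = a s := by
    simp only [a, mul_sub, hea, Finset.mul_sum, ← mul_assoc, hed]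
  have hδ (s t) : a s * c t = δ s t := by
    have h1 (u) : d s u * a₁ u * c t = if u = t then d s u else 0 := by
      rw [mul_assoc, hac, mul_add, hker _ _ (hd s u) (hd u t), add_zero]
      by_cases h : u = t
      · subst h; simp [δ, hde]
      · simp [δ, h]
    simp only [a, sub_mul, Finset.sum_mul, h1, hac]
    simp
  have hφa (s) : φ (a s) = piMatrixUnit k s.1 (o s.1) s.2 := by
    simp [a, ha₁, hd]
  have hsum : ∑ s, c s * a s = 1 := by
    have h1 : φ (∑ s, c s * a s - 1) = 0 := by
      simp only [map_sub, map_sum, map_mul, hc, hφa, piMatrixUnit_mul, if_true, map_one,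
        sum_piMatrixUnit, sub_self]
    have h2 : (∑ s, c s * a s) * (∑ s, c s * a s) = ∑ s, c s * a s := by
      rw [Finset.sum_mul]
      refine Finset.sum_congr rfl fun s _ ↦ ?_
      have h3 (t) : c s * a s * (c t * a t) = if s = t then c s * a t else 0 := by
        rw [mul_assoc, ← mul_assoc (a s), hδ]
        by_cases h : s = t
        · subst h; simp [δ, hea']
        · simp [δ, h]
      simp only [Finset.mul_sum, h3]
      simp
    have h3 := hker _ _ h1 h1
    rw [mul_sub, sub_mul, h2, mul_one, one_mul, sub_self, zero_sub, neg_eq_zero, sub_eq_zero] at h3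
    exact h3
  refine ⟨{
    J := LinearMap.ker φ.toLinearMap
    mul_mem_left := fun a x hx ↦ ?_
    mul_mem_right := fun a x hx ↦ ?_
    mul_eq_zero := fun x hx y hy ↦ hker x y hx hy
    e := e
    e_mul_e := he
    exists_corner := fun x i ↦ ⟨φ x i (o i) (o i), ?_⟩
    mul_mem_of_ne := fun x i j hij ↦ ?_
    S := Σ i, Fin (r i)
    idx := Sigma.fst
    u := c
    v := a
    sum_eq_one := by simp only
        [hea', hsum] }, c, a, fun i h ↦ ?_, hce, hea', fun s ↦ ?_, fun s t hst ↦ ?_⟩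
  · rw [LinearMap.mem_ker, AlgHom.toLinearMap_apply] at *
    rw [map_mul, hx, mul_zero]
  · rw [LinearMap.mem_ker, AlgHom.toLinearMap_apply] at *
    rw [map_mul, hx, zero_mul]
  · rw [LinearMap.mem_ker, AlgHom.toLinearMap_apply, map_sub, map_mul, map_mul, map_smul, hφe,
      piMatrixUnit_mul_mul, sub_self]
  · rw [LinearMap.mem_ker, AlgHom.toLinearMap_apply, map_mul, map_mul, hφe, hφe,
      piMatrixUnit_mul_mul_of_ne hij]
  · rw [LinearMap.mem_ker, AlgHom.toLinearMap_apply, hφe] at h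
    simpa [piMatrixUnit] using congrFun (congrFun (congrFun h i) (o i)) (o i)
  · rw [hδ]; simp [δ]
  · rw [hδ]; simp [δ, hst]

end DualSystem

namespace MvPolynomial

/-- Finitely many polynomial maps from affine spaces of smaller dimension do not cover an affine
space. -/
theorem exists_forall_eval_ne {k F τ : Type} {σ : F → Type} [Field k] [Infinite k] [Finite F]
    [Fintype τ] [∀ i, Fintype (σ i)] (f : ∀ i, τ → MvPolynomial (σ i) k)
    (h : ∀ i, Fintype.card (σ i) < Fintype.card τ) :
    ∃ v : τ → k, ∀ i x, (fun t ↦ eval x (f i t)) ≠ v := by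
  have := Fintype.ofFinite F
  have hp (i) : ∃ p : MvPolynomial τ k, aeval (f i) p = 0 ∧ p ≠ 0 := by
    by_contra! hp
    have h1 := (algebraicIndependent_iff.2 hp).cardinalMk_le_trdeg
    rw [trdeg_of_isDomain, Cardinal.lift_id, Cardinal.mk_fintype, Cardinal.mk_fintype,
      Nat.cast_le] at h1
    exact (h i).not_ge h1
  choose p hp hp0 using hp
  have hP : ∏ i, p i ≠ 0 := Finset.prod_ne_zero_iff.2 fun i _ ↦ hp0 i
  obtain ⟨v, hv⟩ : ∃ v, eval v (∏ i, p i) ≠ 0 := by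
    by_contra! hv
    exact hP (funext fun v ↦ by rw [hv, map_zero])
  refine ⟨v, fun i x hx ↦ hv ?_⟩
  rw [map_prod]
  refine Finset.prod_eq_zero (Finset.mem_univ i) ?_
  have h2 := congrArg (eval x) (hp i)
  rw [map_zero, ← coe_aeval_eq_eval] at h2
  rw [← hx, ← h2, ← coe_aeval_eq_eval]
  exact (DFunLike.congr_fun (comp_aeval (f i) (aeval x)) (p i)).symm

theorem card_lt_card_of_forall_exists_eval_eq {k F σ τ : Type} [Field k] [Infinite k] [Finite F]
    [Fintype σ] [Fintype τ] (f : F → τ → MvPolynomial σ k)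
    (h : ∀ v : τ → k, ∃ i, ∃ x : σ → k, (∃ s, x s = 1) ∧ ∀ t, eval x (f i t) = v t) :
    Fintype.card τ < Fintype.card σ := by
  classical
  by_contra! hle
  let g (i : F × σ) (t : τ) : MvPolynomial {s // s ≠ i.2} k :=
    bind₁ (fun s ↦ if hs : s ≠ i.2 then X ⟨s, hs⟩ else 1) (f i.1 t)
  obtain ⟨v, hv⟩ := exists_forall_eval_ne g fun i ↦
    (Fintype.card_subtype_lt (x := i.2) (by simp)).trans_le hle
  obtain ⟨i, x, ⟨s, hs⟩, hx⟩ := h v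
  refine hv (i, s) (fun s ↦ x s) (_root_.funext fun t ↦ ?_)
  rw [← hx]
  simp only [g]
  rw [← coe_aeval_eq_eval, ← coe_aeval_eq_eval, RingHom.coe_coe, RingHom.coe_coe, aeval_bind₁]
  congr 2
  funext u
  split_ifs with hu
  · simp
  · simp [not_not.1 hu, hs]

end MvPolynomial

theorem ConjLeftIdeal.equivalence (A : Type) [Ring A] : Equivalence (ConjLeftIdeal A) where
  refl L := ⟨1, by simp⟩
  symm := by
    rintro L L' ⟨u, h⟩
    refine ⟨u⁻¹, ?_⟩
    rw [h, Set.image_image]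
    simp [mul_assoc]
  trans := by
    rintro L L' L'' ⟨u, h⟩ ⟨v, h'⟩
    refine ⟨v * u, ?_⟩
    rw [h', h, Set.image_image]
    simp [mul_assoc]

theorem ConjLeftIdeal.exists_mem_iff {A : Type} [Ring A] {L L' : Submodule A A}
    (h : ConjLeftIdeal A L L') : ∃ u : Aˣ, ∀ x, x ∈ L' ↔ x * u ∈ L := by
  obtain ⟨u, h⟩ := h
  refine ⟨u, fun x ↦ ?_⟩
  rw [← SetLike.mem_coe, h]
  constructor
  · rintro ⟨y, hy, rfl⟩
    simpa [mul_assoc] using L.smul_mem (u : A) hy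
  · intro hx
    exact ⟨↑u⁻¹ * (x * u), L.smul_mem _ hx, by simp [mul_assoc]⟩

namespace BasicIdempotents

variable {k A ι : Type} [Field k] [Ring A] [Algebra k A] (D : BasicIdempotents k A ι)

/-- Coordinates on a space of arrows, extended to the whole algebra. -/
theorem exists_arrowCoord [FiniteDimensional k A] (i j : ι) :
    ∃ (b : Fin (Module.finrank k (D.arrows i j)) → A)
      (l : Fin (Module.finrank k (D.arrows i j)) → A →ₗ[k] k),
      (∀ n, b n ∈ D.arrows i j) ∧ ∀ n n', l n (b n') = if n = n' then 1 else 0 := by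
  obtain ⟨g, hg⟩ := (D.arrows i j).subtype.exists_leftInverse_of_injective
    (Submodule.ker_subtype _)
  let B := Module.finBasis k (D.arrows i j)
  refine ⟨fun n ↦ B n, fun n ↦ B.coord n ∘ₗ g, fun n ↦ (B n).2, fun n n' ↦ ?_⟩
  have h1 : g (B n') = B n' := LinearMap.congr_fun hg (B n')
  simp [h1, Finsupp.single_apply, eq_comm]

variable {T U : Type} [Fintype T] {p : T → ι} {q : U → ι} {c a : T → A}

/-- The left ideal cut out by the functionals `f` modulo the radical. -/
def idealOfFunctionals (q : U → ι) (c : T → A) (f : U → T → A →ₗ[k] k) : Submodule A A where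
  carrier := {x | (∀ t, x * c t ∈ D.J) ∧ ∀ u b, ∑ t, f u t (D.e (q u) * b * (x * c t)) = 0}
  add_mem' {x y} hx hy := ⟨fun t ↦ by rw [add_mul]; exact add_mem (hx.1 t) (hy.1 t), fun u b ↦ by
    simp only [add_mul, mul_add, map_add, Finset.sum_add_distrib, hx.2, hy.2, add_zero]⟩
  zero_mem' := ⟨fun t ↦ by rw [zero_mul]; exact zero_mem _, fun u b ↦ by simp⟩
  smul_mem' z x hx := ⟨fun t ↦ by
    rw [smul_eq_mul, mul_assoc]; exact D.mul_mem_left _ _ (hx.1 t), fun u b ↦ by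
    rw [← hx.2 u (b * z)]; simp only [smul_eq_mul, mul_assoc]⟩

theorem mem_idealOfFunctionals_iff {f : U → T → A →ₗ[k] k} {x : A} {j : ι} {w : T → A}
    (hx : ∀ t, x * c t = w t) (hJ : ∀ t, w t ∈ D.J) (he : ∀ t, D.e j * w t = w t) :
    x ∈ D.idealOfFunctionals q c f ↔ ∀ u, q u = j → ∑ t, f u t (w t) = 0 := by
  constructor
  · rintro ⟨-, h⟩ u rfl
    rw [← h u 1]
    simp only [hx, mul_one, he]
  · refine fun h ↦ ⟨fun t ↦ by rw [hx]; exact hJ t, fun u b ↦ ?_⟩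
    simp only [hx]
    by_cases hu : q u = j
    · obtain ⟨z, hz⟩ := D.exists_corner b (q u)
      have h1 (t) : D.e (q u) * b * w t = z • w t := by
        have := D.mul_eq_zero _ hz _ (hJ t)
        rwa [hu, sub_mul, mul_assoc _ (D.e j), he, smul_mul_assoc, he, sub_eq_zero, ← hu] at this
      simp only [h1, map_smul, ← Finset.smul_sum, h u hu, smul_zero]
    · have h1 (t) : D.e (q u) * b * w t = 0 := by
        have := D.mul_eq_zero _ (D.mul_mem_of_ne b _ _ (Ne.symm hu)) _ (hJ t)
        rwa [mul_assoc _ (D.e j), he] at this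
      simp [h1]

theorem exists_coeff {T : Type} {p : T → ι} {c a : T → A} (hce : ∀ t, c t * D.e (p t) = c t)
    (hea : ∀ t, D.e (p t) * a t = a t) (v : A) :
    ∃ G : T → T → k, (∀ s t, p s ≠ p t → G s t = 0) ∧
      ∀ s t, ∀ w ∈ D.J, w * D.e (p s) = w → w * (a s * v * c t) = G s t • w := by
  have key (s t : T) : ∃ z : k, (p s ≠ p t → z = 0) ∧
      ∀ w ∈ D.J, w * D.e (p s) = w → w * (a s * v * c t) = z • w := by
    have h0 : a s * v * c t = D.e (p s) * (a s * v * c t) * D.e (p t) := by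
      rw [mul_assoc _ _ (D.e _), mul_assoc _ (c t), hce, ← mul_assoc, ← mul_assoc, hea]
    by_cases h : p s = p t
    · obtain ⟨z, hz⟩ := D.exists_corner (a s * v * c t) (p s)
      refine ⟨z, fun h' ↦ (h' h).elim, fun w hw hwe ↦ ?_⟩
      have := D.mul_eq_zero _ hw _ hz
      rw [mul_sub, mul_smul_comm, hwe, sub_eq_zero] at this
      rw [h0, ← h, this]
    · refine ⟨0, fun _ ↦ rfl, fun w hw hwe ↦ ?_⟩
      rw [h0, zero_smul]
      exact D.mul_eq_zero _ hw _ (D.mul_mem_of_ne _ _ _ (Ne.symm h))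
  choose G h1 h2 using key
  exact ⟨G, h1, h2⟩

theorem exists_coeff_of_conj [Fintype U] (hce : ∀ t, c t * D.e (p t) = c t)
    (hea : ∀ t, D.e (p t) * a t = a t) (hac : ∀ t, a t * c t = D.e (p t))
    (hac' : ∀ s t, s ≠ t → a s * c t = 0) {f f' : U → T → A →ₗ[k] k}
    (h : ConjLeftIdeal A (D.idealOfFunctionals q c f) (D.idealOfFunctionals q c f')) :
    ∃ (G : T → T → k) (H : U → U → k), (∀ s t, p s ≠ p t → G s t = 0) ∧
      (∀ u v, q u ≠ q v → H u v = 0) ∧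
      ∀ u s, ∀ w ∈ D.arrows (p s) (q u), f' u s w = ∑ v, ∑ t, H u v * (G s t * f v t w) := by
  classical
  obtain ⟨v, hv⟩ := h.exists_mem_iff
  obtain ⟨G, hG, hGw⟩ := D.exists_coeff hce hea v
  have key (u : U) : ∃ H : U → k, (∀ v, q u ≠ q v → H v = 0) ∧
      ∀ s, ∀ w ∈ D.arrows (p s) (q u), f' u s w = ∑ v, ∑ t, H v * (G s t * f v t w) := by
    let W := ∀ s, D.arrows (p s) (q u)
    let pr (s : T) : W →ₗ[k] A := (D.arrows (p s) (q u)).subtype ∘ₗ LinearMap.proj s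
    let l' : W →ₗ[k] k := ∑ s, f' u s ∘ₗ pr s
    let l (y : {y // q u = q y}) : W →ₗ[k] k := ∑ t, ∑ s, G s t • (f y t ∘ₗ pr s)
    have hl' (w : W) : l' w = ∑ s, f' u s (w s) := by
      simp only [l', LinearMap.sum_apply]
      rfl
    have hlw (y) (w : W) : l y w = ∑ t, ∑ s, G s t * f y t (w s) := by
      simp only [l, LinearMap.sum_apply, LinearMap.smul_apply, smul_eq_mul]
      rfl
    have hl : l' ∈ Submodule.span k (Set.range l) := by
      refine mem_span_of_iInf_ker_le_ker fun w hw ↦ ?_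
      simp only [Submodule.mem_iInf, LinearMap.mem_ker, hl', hlw] at hw ⊢
      have hwJ (s) : (w s : A) ∈ D.J := (w s).2.1
      have hwe (s) : D.e (q u) * (w s : A) = w s := (w s).2.2.1
      have hwp (s) : (w s : A) * D.e (p s) = w s := (w s).2.2.2
      have h1 : (∑ s, (w s : A) * a s) ∈ D.idealOfFunctionals q c f' := by
        rw [hv, D.mem_idealOfFunctionals_iff (j := q u) (w := fun t ↦ ∑ s, G s t • (w s : A))]
        · intro y hy
          simpa using hw ⟨y, hy.symm⟩
        · intro t
          simp only [Finset.sum_mul]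
          refine Finset.sum_congr rfl fun s _ ↦ ?_
          rw [← hGw s t _ (hwJ s) (hwp s)]
          simp only [mul_assoc]
        · exact fun t ↦ sum_mem fun s _ ↦ D.J.smul_mem _ (hwJ s)
        · intro t
          simp only [Finset.mul_sum, mul_smul_comm, hwe]
      rw [D.mem_idealOfFunctionals_iff (j := q u) (w := fun t ↦ (w t : A)) _ hwJ hwe] at h1
      · exact h1 u rfl
      · intro t
        rw [Finset.sum_mul, Finset.sum_eq_single t]
        · rw [mul_assoc, hac, hwp]
        · intro s _ hs
          rw [mul_assoc, hac' s t hs, mul_zero]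
        · simp
    obtain ⟨H, hH⟩ := (Submodule.mem_span_range_iff_exists_fun k).1 hl
    refine ⟨fun v ↦ if hv : q u = q v then H ⟨v, hv⟩ else 0, fun v hv ↦ dif_neg hv,
      fun s w hw ↦ ?_⟩
    let x : W := Pi.single s ⟨w, hw⟩
    have hx (t) (g : A →ₗ[k] k) : g (x t) = if t = s then g w else 0 := by
      by_cases ht : t = s
      · subst ht; simp [x]
      · simp [x, ht]
    have h2 := LinearMap.congr_fun hH x
    simp only [LinearMap.sum_apply, LinearMap.smul_apply, hl', hlw, hx, mul_ite, mul_zero,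
      Finset.sum_ite_eq', Finset.mem_univ, if_true, smul_eq_mul] at h2
    rw [← h2]
    simp only [← Finset.mul_sum]
    rw [← Fintype.sum_subtype_add_sum_subtype (fun v ↦ q u = q v),
      Finset.sum_eq_zero (s := (Finset.univ : Finset {v // ¬ q u = q v})), add_zero]
    · exact Finset.sum_congr rfl fun y _ ↦ by rw [dif_pos y.2]
    · exact fun y _ ↦ by rw [dif_neg y.2, zero_mul]
  choose H hH hH' using key
  exact ⟨G, H, hG, hH, hH'⟩


theorem card_lt_card [FiniteDimensional k A] [Infinite k] [Fintype U] [Nonempty T] [DecidableEq ι]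
    (hA : HasFinitelyManyConjClassesOfLeftIdeals A) (hce : ∀ t, c t * D.e (p t) = c t)
    (hea : ∀ t, D.e (p t) * a t = a t) (hac : ∀ t, a t * c t = D.e (p t))
    (hac' : ∀ s t, s ≠ t → a s * c t = 0) :
    ∑ u, ∑ s, Module.finrank k (D.arrows (p s) (q u)) <
      Fintype.card {z : T × T // p z.1 = p z.2} + Fintype.card {z : U × U // q z.1 = q z.2} := by
  classical
  choose b l hb hl using D.exists_arrowCoord
  let τ := Σ (u : U) (s : T), Fin (Module.finrank k (D.arrows (p s) (q u)))
  let f (v : τ → k) (u : U) (s : T) : A →ₗ[k] k := ∑ n, v ⟨u, s, n⟩ • l (p s) (q u) n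
  let w (z : τ) : A := b (p z.2.1) (q z.1) z.2.2
  have hf (v : τ → k) (z : τ) : f v z.1 z.2.1 (w z) = v z := by
    simp only [f, w, LinearMap.sum_apply, LinearMap.smul_apply, hl, smul_eq_mul, mul_ite, mul_one,
      mul_zero, Finset.sum_ite_eq', Finset.mem_univ, if_true]
    rfl
  let L (v : τ → k) := D.idealOfFunctionals q c (f v)
  let v₀ (Q : Quot (ConjLeftIdeal A)) : τ → k :=
    if h : ∃ v, Quot.mk _ (L v) = Q then h.choose else 0
  let σ := {z : T × T // p z.1 = p z.2} ⊕ {z : U × U // q z.1 = q z.2}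
  let XG (s t : T) : MvPolynomial σ k :=
    if h : p s = p t then MvPolynomial.X (Sum.inl ⟨(s, t), h⟩) else 0
  let XH (u v : U) : MvPolynomial σ k :=
    if h : q u = q v then MvPolynomial.X (Sum.inr ⟨(u, v), h⟩) else 0
  let g (Q : Quot (ConjLeftIdeal A)) (z : τ) : MvPolynomial σ k :=
    ∑ u, ∑ t, XH z.1 u * (XG z.2.1 t * MvPolynomial.C (f (v₀ Q) u t (w z)))
  have hcard : ∑ u, ∑ s, Module.finrank k (D.arrows (p s) (q u)) = Fintype.card τ := by
    simp [τ, Fintype.card_sigma]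
  rw [hcard, ← Fintype.card_sum]
  have : Finite (Quot (ConjLeftIdeal A)) := hA
  refine MvPolynomial.card_lt_card_of_forall_exists_eval_eq g fun v ↦
    ⟨Quot.mk _ (L v), ?_⟩
  have hex : ∃ v', Quot.mk (ConjLeftIdeal A) (L v') = Quot.mk _ (L v) := ⟨v, rfl⟩
  have hconj : ConjLeftIdeal A (L (v₀ (Quot.mk _ (L v)))) (L v) := by
    have h1 : Quot.mk (ConjLeftIdeal A) (L (v₀ (Quot.mk _ (L v)))) = Quot.mk _ (L v) := by
      simp only [v₀]
      rw [dif_pos hex]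
      exact hex.choose_spec
    exact (ConjLeftIdeal.equivalence A).eqvGen_iff.1 (Quot.eqvGen_exact h1)
  obtain ⟨G, H, hG, hH, hGH⟩ := D.exists_coeff_of_conj hce hea hac hac' hconj
  have key (G : T → T → k) (H : U → U → k) (hG : ∀ s t, p s ≠ p t → G s t = 0)
      (hH : ∀ u v, q u ≠ q v → H u v = 0)
      (hGH : ∀ z : τ, v z = ∑ u, ∑ t, H z.1 u * (G z.2.1 t *
        f (v₀ (Quot.mk _ (L v))) u t (w z))) (s t) (hst : p s = p t) (h1 : G s t = 1) :
      ∃ x : σ → k, (∃ s, x s = 1) ∧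
        ∀ z, MvPolynomial.eval x (g (Quot.mk _ (L v)) z) = v z := by
    let x : σ → k := Sum.elim (fun z ↦ G z.1.1 z.1.2) (fun z ↦ H z.1.1 z.1.2)
    have hXG (s t) : MvPolynomial.eval x (XG s t) = G s t := by
      by_cases h : p s = p t
      · simp [XG, h, x]
      · simp [XG, h, hG]
    have hXH (s t) : MvPolynomial.eval x (XH s t) = H s t := by
      by_cases h : q s = q t
      · simp [XH, h, x]
      · simp [XH, h, hH]
    refine ⟨x, ⟨Sum.inl ⟨(s, t), hst⟩, h1⟩, fun z ↦ ?_⟩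
    simp only [g, map_sum, map_mul, hXG, hXH, MvPolynomial.eval_C]
    exact (hGH z).symm
  have hGH' (z : τ) := (hf v z).symm.trans (hGH z.1 z.2.1 (w z) (hb _ _ _))
  by_cases hne : ∃ s t, G s t ≠ 0
  · obtain ⟨s, t, hst⟩ := hne
    refine key (fun s' t' ↦ (G s t)⁻¹ * G s' t') (fun u v ↦ G s t * H u v)
      (fun s' t' h ↦ by rw [hG _ _ h, mul_zero]) (fun s' t' h ↦ by rw [hH _ _ h, mul_zero])
      (fun z ↦ ?_) s t (by_contra fun h ↦ hst (hG _ _ h)) (inv_mul_cancel₀ hst)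
    rw [hGH']
    refine Finset.sum_congr rfl fun u _ ↦ Finset.sum_congr rfl fun t' _ ↦ ?_
    field_simp
  · push Not at hne
    obtain ⟨s⟩ := ‹Nonempty T›
    refine key (fun s' t' ↦ if p s' = p t' then 1 else 0) 0 (fun s' t' h ↦ if_neg h)
      (fun _ _ _ ↦ rfl) (fun z ↦ ?_) s s rfl (if_pos rfl)
    rw [hGH']
    simp [hne]

end BasicIdempotents

theorem card_sigma_prod_fst_eq {K : Type} [Fintype K] [DecidableEq K] (x : K → ℕ) :
    Fintype.card {z : (Σ i, Fin (x i)) × (Σ i, Fin (x i)) // z.1.1 = z.2.1} = ∑ i, x i ^ 2 := by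
  let f (z : Σ i, Fin (x i) × Fin (x i)) :
      {z : (Σ i, Fin (x i)) × (Σ i, Fin (x i)) // z.1.1 = z.2.1} :=
    ⟨(⟨z.1, z.2.1⟩, ⟨z.1, z.2.2⟩), rfl⟩
  have hf : Function.Bijective f := by
    constructor
    · rintro ⟨i, a, b⟩ ⟨j, c, d⟩ h
      simp only [f, Subtype.mk.injEq, Prod.mk.injEq, Sigma.mk.injEq] at h
      obtain ⟨⟨rfl, h1⟩, -, h2⟩ := h
      rw [eq_of_heq h1, eq_of_heq h2]
    · rintro ⟨⟨⟨i, a⟩, ⟨j, b⟩⟩, h⟩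
      dsimp only at h
      subst h
      exact ⟨⟨i, a, b⟩, rfl⟩
  rw [← Fintype.card_of_bijective hf, Fintype.card_sigma]
  simp [sq]

theorem BasicIdempotents.bipartiteForm_pos {k A : Type} [Field k] [Infinite k] [Ring A]
    [Algebra k A] [FiniteDimensional k A] {K : Type} [Fintype K] [DecidableEq K] {r : K → ℕ}
    (D : BasicIdempotents k A K) (hA : HasFinitelyManyConjClassesOfLeftIdeals A)
    {c a : (Σ i, Fin (r i)) → A} (hce : ∀ s, c s * D.e s.1 = c s)
    (hea : ∀ s, D.e s.1 * a s = a s) (hac : ∀ s, a s * c s = D.e s.1)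
    (hac' : ∀ s t, s ≠ t → a s * c t = 0) (x y : K → ℕ) (hx : ∀ i, x i ≤ r i)
    (hxy : x ≠ 0 ∨ y ≠ 0) :
    0 < bipartiteForm (fun i j ↦ Module.finrank k (D.arrows i j))
      (fun i ↦ (x i : ℤ)) (fun j ↦ (y j : ℤ)) := by
  by_cases h0 : x = 0
  · obtain ⟨j, hj⟩ := Function.ne_iff.1 (hxy.resolve_left (not_not.2 h0))
    have h1 : 0 < ∑ j, (y j : ℤ) ^ 2 := by
      refine Finset.sum_pos' (fun _ _ ↦ by positivity) ⟨j, Finset.mem_univ j, ?_⟩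
      have : y j ≠ 0 := hj
      positivity
    simpa [bipartiteForm, h0] using h1
  · obtain ⟨i, hi⟩ := Function.ne_iff.1 h0
    let emb (t : Σ i, Fin (x i)) : Σ i, Fin (r i) := ⟨t.1, Fin.castLE (hx t.1) t.2⟩
    have hemb : Function.Injective emb := by
      rintro ⟨i, s⟩ ⟨j, t⟩ h
      simp only [emb, Sigma.mk.injEq] at h
      obtain ⟨rfl, h⟩ := h
      rw [Fin.castLE_injective _ (eq_of_heq h)]
    have : Nonempty (Σ i, Fin (x i)) := ⟨⟨i, 0, Nat.pos_of_ne_zero hi⟩⟩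
    have h1 := D.card_lt_card (T := Σ i, Fin (x i)) (U := Σ j, Fin (y j)) (p := Sigma.fst)
      (q := Sigma.fst) hA (fun t ↦ hce (emb t)) (fun t ↦ hea (emb t)) (fun t ↦ hac (emb t))
      (fun s t hst ↦ hac' _ _ (hemb.ne hst))
    rw [card_sigma_prod_fst_eq, card_sigma_prod_fst_eq, Fintype.sum_sigma] at h1
    simp only [Fintype.sum_sigma] at h1
    replace h1 : ∑ j, ∑ _ : Fin (y j), ∑ i, ∑ _ : Fin (x i), Module.finrank k (D.arrows i j) <
      ∑ i, x i ^ 2 + ∑ j, y j ^ 2 := h1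
    simp only [Finset.sum_const, Finset.card_univ, Fintype.card_fin, smul_eq_mul,
      Finset.mul_sum] at h1
    rw [Finset.sum_comm] at h1
    zify at h1
    rw [bipartiteForm, sub_pos]
    convert h1 using 1
    exact Finset.sum_congr rfl fun i _ ↦ Finset.sum_congr rfl fun j _ ↦ by ring

/-- let `k` be an algebraically closed field and `A` a finite-dimensional unital
`k`-algebra with `J(A)² = 0` and `A/J(A) ≅ M_{r₁}(k) × ⋯ × M_{r_K}(k)` with all `rᵢ ≥ 6`.
Then `A` has finitely many conjugacy classes of left ideals iff `A` is of finite
representation type. -/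
theorem finConjClasses_iff_finiteRepType
    (k : Type) [Field k] [IsAlgClosed k]
    (A : Type) [Ring A] [Algebra k A] [FiniteDimensional k A]
    (hJ2 : ∀ x ∈ (⊥ : Ideal A).jacobson, ∀ y ∈ (⊥ : Ideal A).jacobson, x * y = 0)
    (K : ℕ) (r : Fin K → ℕ) (hr : ∀ i, 6 ≤ r i)
    (hsemisimple : ∃ φ : A →ₐ[k] (∀ i : Fin K, Matrix (Fin (r i)) (Fin (r i)) k),
      Function.Surjective φ ∧ RingHom.ker φ.toRingHom = (⊥ : Ideal A).jacobson) :
    HasFinitelyManyConjClassesOfLeftIdeals A ↔ FiniteRepresentationType A := by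
  obtain ⟨φ, hφ, hker⟩ := hsemisimple
  have hφ0 (x y : A) (hx : φ x = 0) (hy : φ y = 0) : x * y = 0 :=
    hJ2 x (hker.le hx) y (hker.le hy)
  constructor
  · intro hA
    have : Infinite k := IsAlgClosed.instInfinite
    obtain ⟨D, c, a, -, hce, hea, hac, hac'⟩ := BasicIdempotents.exists_dualSystem φ hφ hφ0
      fun i ↦ (Nat.succ_pos 5).trans_le (hr i)
    refine D.finiteRepresentationType fun x y hxy ↦ bipartiteForm.pos_of_pos_of_le_six
      (fun x y hx _ hxy ↦ D.bipartiteForm_pos hA hce hea hac hac' x y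
        (fun i ↦ (hx i).trans (hr i)) hxy) _ _ (fun i ↦ Int.natCast_nonneg _)
      (fun i ↦ Int.natCast_nonneg _) ?_
    refine hxy.imp (mt fun h ↦ funext fun i ↦ ?_) (mt fun h ↦ funext fun i ↦ ?_) <;>
    · exact Int.natCast_eq_zero.1 (congrFun h i)
  · have : IsArtinianRing A := IsArtinianRing.of_finite k A
    have hstable : StableRangeOne A :=
      (StableRangeOne.pi fun i ↦ StableRangeOne.matrix k (Fin (r i))).of_surjective φ.toRingHom hφ
        fun x hx ↦ hφ0 x x hx hx
    exact hasFinitelyManyConjClassesOfLeftIdeals_of_quotient fun L L' ⟨f⟩ ↦ hstable.conjLeftIdeal f
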